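/- arXiv:1901.01917 — 2 statements merged into one kernel-verified Lean document; each statement's English description precedes it below -/
import Mathlib

section
/- Fix an integer q ≥ 3. For each positive integer n let u(n) denote the number of q-element subsets S of the grid {1,…,n} × {1,…,n} ⊆ ℤ² such that no two distinct points of S differ by an integer multiple of (1,1) or of (1,−1) (nonattacking placements of q bishops on the n × n board). Then u is a quasipolynomial in n of period exactly 2: there exist polynomials p₀, p₁ with rational coefficients such that u(n) = p₀(n) for all even n ≥ 1 and u(n) = p₁(n) for all odd n ≥ 1, and there is no single polynomial p with u(n) = p(n) for all n ≥ 1. -/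
/-! Common definitions: boards, pieces, hyperplane arrangements, rank,
antipode maps, trajectories, augmentations, crossing points, denominators. -/

noncomputable section

/-- A point of the plane. -/
abbrev Pt : Type := ℝ × ℝ

/-- Dot product on `ℝ²`. -/
def dotp (u v : Pt) : ℝ := u.1 * v.1 + u.2 * v.2

/-- A board: a rational convex polygon `{z | ∀ j, a_j · z ≤ β_j}`, bounded, with
nonempty interior, each defining line meeting the board in at least two points (an edge). -/
structure Board where
  s : ℕ
  A : Fin s → Pt
  β : Fin s → ℝ
  A_rat : ∀ j, ∃ p q : ℚ, A j = ((p : ℝ), (q : ℝ))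
  β_rat : ∀ j, ∃ p : ℚ, β j = (p : ℝ)
  bounded : Bornology.IsBounded {z : Pt | ∀ j, dotp (A j) z ≤ β j}
  int_ne : (interior {z : Pt | ∀ j, dotp (A j) z ≤ β j}).Nonempty
  edges : ∀ j, ∃ u v : Pt, u ≠ v ∧ (∀ k, dotp (A k) u ≤ β k) ∧ (∀ k, dotp (A k) v ≤ β k) ∧
    dotp (A j) u = β j ∧ dotp (A j) v = β j

/-- The set of points of the board. -/
def Board.set (Bd : Board) : Set Pt := {z | ∀ j, dotp (Bd.A j) z ≤ Bd.β j}

/-- The corners of the board: its extreme points. -/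
def Board.corners (Bd : Board) : Set Pt := Set.extremePoints ℝ Bd.set

/-- A two-move rider: two nonparallel basic moves `(c r, d r)`, each with coprime entries. -/
structure Piece where
  c : Bool → ℤ
  d : Bool → ℤ
  coprime : ∀ r, Int.gcd (c r) (d r) = 1
  nonparallel : c false * d true - c true * d false ≠ 0

/-- The basic move vector of `P` of type `r`, as a vector in `ℝ²`. -/
def Piece.mv (P : Piece) (r : Bool) : Pt := ((P.c r : ℝ), (P.d r : ℝ))

/-- The normal vector `(d_r, -c_r)` of the attack equations of type `r`. -/
def Piece.anorm (P : Piece) (r : Bool) : Pt := ((P.d r : ℝ), -(P.c r : ℝ))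

/-- A configuration of `q` points in the plane; the configuration space is `ℝ^{2q}`. -/
abbrev Conf (q : ℕ) : Type := Fin q → Pt

/-- Dot product on the configuration space `ℝ^{2q}`. -/
def confDot {q : ℕ} (u w : Conf q) : ℝ := ∑ k, dotp (u k) (w k)

/-- The vector of `ℝ^{2q}` whose `i`-th planar component is `v` and all others `0`. -/
def unitVec {q : ℕ} (i : Fin q) (v : Pt) : Conf q := fun k => if k = i then v else 0

/-- The normal vector in `ℝ^{2q}` of the attack hyperplane `(w_i - w_j) · v = 0`. -/
def attackNormal {q : ℕ} (i j : Fin q) (v : Pt) : Conf q :=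
  fun k => if k = i then v else if k = j then -v else 0

/-- The hyperplane arrangement `H(z)` associated to a configuration `z`: each hyperplane
`{w | n · w = β}` is recorded as the pair `(n, β)`.  It consists of the attack hyperplanes
through `z` and the fixation hyperplanes through `z`. -/
def HArr (Bd : Board) (P : Piece) {q : ℕ} (z : Conf q) : Set (Conf q × ℝ) :=
  {h | (∃ i j : Fin q, ∃ r : Bool, i < j ∧ dotp (z i - z j) (P.anorm r) = 0 ∧
          h = (attackNormal i j (P.anorm r), 0)) ∨
       (∃ i : Fin q, ∃ e : Fin Bd.s, dotp (Bd.A e) (z i) = Bd.β e ∧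
          h = (unitVec i (Bd.A e), Bd.β e))}

/-- The rank of a configuration `z`: the dimension of the span of the normal vectors
of the hyperplanes of `H(z)`. -/
def confRank (Bd : Board) (P : Piece) {q : ℕ} (z : Conf q) : ℕ :=
  Module.finrank ℝ (Submodule.span ℝ (Prod.fst '' HArr Bd P z))

/-- A configuration has full rank when its rank is `2q`. -/
def FullRank (Bd : Board) (P : Piece) {q : ℕ} (z : Conf q) : Prop :=
  confRank Bd P z = 2 * q

/-- `z ∈ B^q`. -/
def InBoard (Bd : Board) {q : ℕ} (z : Conf q) : Prop := ∀ i, z i ∈ Bd.set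

/-- A vertex of the inside-out polytope `(B^q, A_P^q)`: a point of `B^q` that is the unique
common point of some subset of its associated hyperplane arrangement. -/
def IsVertex (Bd : Board) (P : Piece) {q : ℕ} (z : Conf q) : Prop :=
  InBoard Bd z ∧
    ∃ H' ⊆ HArr Bd P z, {w : Conf q | ∀ h ∈ H', confDot h.1 w = h.2} = {z}

/-- The line through `b` in direction `v` meets the interior of `R`. -/
def meetsInterior (R : Set Pt) (v : Pt) (b : Pt) : Prop := ∃ t : ℝ, b + t • v ∈ interior R

/-- `b'` is the antipode of `b` in direction `v`: if the line through `b` with direction `v`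
misses the interior of `R` then `b' = b`; otherwise `b'` is the second intersection point of
the line with the boundary of `R`. -/
def AntipRel (R : Set Pt) (v : Pt) (b b' : Pt) : Prop :=
  (¬ meetsInterior R v b → b' = b) ∧
  (meetsInterior R v b → b' ∈ frontier R ∧ b' ≠ b ∧ ∃ t : ℝ, b' = b + t • v)

/-- `s` is the antipode map of `R` in direction `v`. -/
def IsAntipodeMap (R : Set Pt) (v : Pt) (s : Pt → Pt) : Prop :=
  ∀ b ∈ frontier R, AntipRel R v b (s b)

/-- The move type used at step `i` of an alternating sequence whose step `0` uses type `st`. -/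
def altMove (st : Bool) (i : ℕ) : Bool := if i % 2 = 0 then st else !st

/-- A trajectory: a finite sequence `b 0, …, b (l-1)` of distinct boundary points of `R`,
each obtained from the previous by an antipode map, the move types alternating. -/
def IsTrajectory (R : Set Pt) (mv : Bool → Pt) (l : ℕ) (b : ℕ → Pt) (st : Bool) : Prop :=
  1 ≤ l ∧ (∀ i, i < l → b i ∈ frontier R) ∧
  (∀ i j, i < l → j < l → b i = b j → i = j) ∧
  (∀ i, i + 1 < l → AntipRel R (mv (altMove st i)) (b i) (b (i + 1)))

/-- A cyclical trajectory: additionally the first point is the antipode of the last,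
the move type continuing the alternation. -/
def IsCyclical (R : Set Pt) (mv : Bool → Pt) (l : ℕ) (b : ℕ → Pt) (st : Bool) : Prop :=
  IsTrajectory R mv l b st ∧ AntipRel R (mv (altMove st (l - 1))) (b (l - 1)) (b 0)

/-- The configuration `(b 1, …, b l) ∈ B^l` formed by the points of a trajectory. -/
def trajConf (l : ℕ) (b : ℕ → Pt) : Conf l := fun i => b i

/-- A corner trajectory: a trajectory containing a corner of the board. -/
def IsCornerTraj (Bd : Board) (P : Piece) (l : ℕ) (b : ℕ → Pt) (st : Bool) : Prop :=
  IsTrajectory Bd.set P.mv l b st ∧ ∃ i, i < l ∧ b i ∈ Bd.corners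

/-- A rigid cycle: a cyclical trajectory of full rank. -/
def IsRigidCycle (Bd : Board) (P : Piece) (l : ℕ) (b : ℕ → Pt) (st : Bool) : Prop :=
  IsCyclical Bd.set P.mv l b st ∧ confRank Bd P (trajConf l b) = 2 * l

/-- The trajectory can be extended backwards (the relevant antipode of its first point
is a different point). -/
def CanExtendBack (R : Set Pt) (mv : Bool → Pt) (b : ℕ → Pt) (st : Bool) : Prop :=
  meetsInterior R (mv (altMove st 1)) (b 0)

/-- The trajectory can be extended forwards (the relevant antipode of its last point
is a different point). -/
def CanExtendFwd (R : Set Pt) (mv : Bool → Pt) (l : ℕ) (b : ℕ → Pt) (st : Bool) : Prop :=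
  meetsInterior R (mv (altMove st (l - 1))) (b (l - 1))

/-- `a 0, …, a (L-1)` is the augmentation of the trajectory `b 0, …, b (l-1)`:
the trajectory with the antipode of its first point prepended whenever it differs from the
first point, and the antipode of its last point appended whenever it differs from the
last point. -/
def IsAugmentation (R : Set Pt) (mv : Bool → Pt) (l : ℕ) (b : ℕ → Pt) (st : Bool)
    (L : ℕ) (a : ℕ → Pt) : Prop :=
  ∃ off : ℕ,
    (∀ i, i < l → a (i + off) = b i) ∧
    (CanExtendBack R mv b st → off = 1 ∧ AntipRel R (mv (altMove st 1)) (b 0) (a 0)) ∧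
    (¬ CanExtendBack R mv b st → off = 0) ∧
    (CanExtendFwd R mv l b st →
      L = l + off + 1 ∧ AntipRel R (mv (altMove st (l - 1))) (b (l - 1)) (a (l + off))) ∧
    (¬ CanExtendFwd R mv l b st → L = l + off)

/-- `c` is a crossing point of the two sequences: an interior point of `R` lying on a
segment of each. -/
def CrossingOfSeqs (R : Set Pt) (La : ℕ) (a : ℕ → Pt) (Lb : ℕ) (bb : ℕ → Pt) (c : Pt) : Prop :=
  c ∈ interior R ∧ ∃ i j, i + 1 < La ∧ j + 1 < Lb ∧
    c ∈ segment ℝ (a i) (a (i + 1)) ∧ c ∈ segment ℝ (bb j) (bb (j + 1))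

/-- `c` is a self-crossing point of the sequence: an interior point of `R` lying on two
distinct segments of the sequence. -/
def SelfCrossingOfSeq (R : Set Pt) (La : ℕ) (a : ℕ → Pt) (c : Pt) : Prop :=
  c ∈ interior R ∧ ∃ i j, i ≠ j ∧ i + 1 < La ∧ j + 1 < La ∧
    c ∈ segment ℝ (a i) (a (i + 1)) ∧ c ∈ segment ℝ (a j) (a (j + 1))

/-- `x` is a rational number whose denominator (in lowest terms) divides `D`. -/
def DenDvd (x : ℝ) (D : ℕ) : Prop := ∃ p : ℚ, (p : ℝ) = x ∧ p.den ∣ D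

/-- Both coordinates of `z` are rational with denominators dividing `D`. -/
def PtDenDvd (z : Pt) (D : ℕ) : Prop := DenDvd z.1 D ∧ DenDvd z.2 D

/-- `D` is the denominator of the inside-out polytope `(B^q, A_P^q)`: the least common
multiple of the denominators of the coordinates of all of its vertices. -/
def IsIOPDenom (Bd : Board) (P : Piece) (q : ℕ) (D : ℕ) : Prop :=
  (∀ z : Conf q, IsVertex Bd P z → ∀ i, PtDenDvd (z i) D) ∧
  (∀ D' : ℕ, (∀ z : Conf q, IsVertex Bd P z → ∀ i, PtDenDvd (z i) D') → D ∣ D')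

/-- A finite family of finite sequences of points (with starting move types),
to be used as a family of trajectories. -/
structure TrajFamily where
  m : ℕ
  len : ℕ → ℕ
  pts : ℕ → ℕ → Pt
  st : ℕ → Bool

/-- Every member of the family is a trajectory. -/
def TrajFamily.Wf (F : TrajFamily) (R : Set Pt) (mv : Bool → Pt) : Prop :=
  ∀ k, k < F.m → IsTrajectory R mv (F.len k) (F.pts k) (F.st k)

/-- The members of the family partition the set `S`: their point sets are pairwise disjoint
with union `S`. -/
def TrajFamily.Partitions (F : TrajFamily) (S : Set Pt) : Prop :=
  {p | ∃ k, k < F.m ∧ ∃ i, i < F.len k ∧ F.pts k i = p} = S ∧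
  ∀ k k', k < F.m → k' < F.m → k ≠ k' →
    ∀ i i', i < F.len k → i' < F.len k' → F.pts k i ≠ F.pts k' i'

/-- The family is a partition into maximal trajectories: no point of one member is an
antipode of a point of a different member (no edge of the antipode graph joins two
distinct members). -/
def TrajFamily.Maximal (F : TrajFamily) (R : Set Pt) (mv : Bool → Pt) : Prop :=
  ∀ k k', k < F.m → k' < F.m → k ≠ k' →
    ∀ i i', i < F.len k → i' < F.len k' →
      ∀ r : Bool, ¬ AntipRel R (mv r) (F.pts k i) (F.pts k' i')

/-- The unit square `[0,1]²`. -/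
def unitSq : Set Pt := Set.Icc ((0, 0) : Pt) ((1, 1) : Pt)

end

noncomputable section

/-- Two lattice points attack each other as bishops when they differ by an integer
multiple of `(1,1)` or of `(1,-1)`. -/
def bishopAttack (p r : ℤ × ℤ) : Prop :=
  (∃ k : ℤ, r - p = (k, k)) ∨ (∃ k : ℤ, r - p = (k, -k))

/-- The number of nonattacking placements of `q` bishops on the `n × n` board. -/
def bishopCount (q n : ℕ) : ℕ :=
  Nat.card {S : Finset (ℤ × ℤ) // S.card = q ∧
    (∀ p ∈ S, 1 ≤ p.1 ∧ p.1 ≤ (n : ℤ) ∧ 1 ≤ p.2 ∧ p.2 ≤ (n : ℤ)) ∧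
    (∀ p ∈ S, ∀ r ∈ S, p ≠ r → ¬ bishopAttack p r)}

section RookPlacements

variable {α : Type*} (row col : α → ℤ)

open Classical in
/-- Nonattacking placements of `k` rooks on the board `B`, whose cells have the rows and columns
given by `row` and `col`. -/
def rookPlacements (B : Finset α) (k : ℕ) : Finset (Finset α) :=
  {S ∈ B.powersetCard k | Set.InjOn row S ∧ Set.InjOn col S}

variable {row col}

lemma mem_rookPlacements {B S : Finset α} {k : ℕ} :
    S ∈ rookPlacements row col B k ↔
      (S ⊆ B ∧ S.card = k) ∧ Set.InjOn row S ∧ Set.InjOn col S := by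
  simp [rookPlacements, Finset.mem_powersetCard]

lemma card_rookPlacements_zero (B : Finset α) : (rookPlacements row col B 0).card = 1 := by
  rw [Finset.card_eq_one]
  refine ⟨∅, ?_⟩
  ext S
  rw [mem_rookPlacements, Finset.mem_singleton, Finset.card_eq_zero]
  constructor
  · exact fun h => h.1.2
  · rintro rfl
    simp

lemma card_rookPlacements_empty (k : ℕ) :
    (rookPlacements row col (∅ : Finset α) (k + 1)).card = 0 := by
  rw [Finset.card_eq_zero, Finset.eq_empty_iff_forall_notMem]
  intro S hS
  rw [mem_rookPlacements, Finset.subset_empty] at hS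
  obtain ⟨⟨rfl, h⟩, -⟩ := hS
  simp at h

variable [DecidableEq α]

/-- Rook numbers after adding a new row `E` meeting every column of `B`. -/
lemma card_rookPlacements_union_row {B E : Finset α} {s : ℤ} (hE : ∀ e ∈ E, row e = s)
    (hB : ∀ b ∈ B, row b ≠ s) (hcol : ∀ b ∈ B, ∃ e ∈ E, col e = col b)
    (hinj : Set.InjOn col E) (k : ℕ) :
    (rookPlacements row col (B ∪ E) (k + 1)).card + k * (rookPlacements row col B k).card =
      (rookPlacements row col B (k + 1)).card + E.card * (rookPlacements row col B k).card := by
  classical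
  have hfree : ∀ S ∈ rookPlacements row col B k,
      (E.filter (fun e => col e ∉ S.image col)).card + k = E.card := by
    intro S hS
    rw [mem_rookPlacements] at hS
    obtain ⟨⟨hSB, hSk⟩, -, hSc⟩ := hS
    have h1 : (E.filter (fun e => col e ∈ S.image col)).card = k := by
      rw [← hSk, ← Finset.card_image_of_injOn hSc,
        ← Finset.card_image_of_injOn (s := E.filter (fun e => col e ∈ S.image col)) (f := col)
          (hinj.mono (by intro x hx; simp at hx; simpa using hx.1))]
      congr 1
      ext c
      simp only [Finset.mem_image, Finset.mem_filter]
      constructor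
      · rintro ⟨e, ⟨-, h⟩, rfl⟩
        exact h
      · rintro ⟨b, hb, rfl⟩
        obtain ⟨e, he, hec⟩ := hcol b (hSB hb)
        exact ⟨e, ⟨he, b, hb, hec.symm⟩, hec⟩
    have := Finset.card_filter_add_card_filter_not (s := E) (fun e => col e ∈ S.image col)
    omega
  have hold : (rookPlacements row col (B ∪ E) (k + 1)).filter (fun S => S ⊆ B) =
      rookPlacements row col B (k + 1) := by
    ext S
    simp only [Finset.mem_filter, mem_rookPlacements]
    constructor
    · rintro ⟨⟨⟨-, h1⟩, h2⟩, h3⟩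
      exact ⟨⟨h3, h1⟩, h2⟩
    · rintro ⟨⟨h3, h1⟩, h2⟩
      exact ⟨⟨⟨h3.trans Finset.subset_union_left, h1⟩, h2⟩, h3⟩
  have hnew : ((rookPlacements row col (B ∪ E) (k + 1)).filter (fun S => ¬ S ⊆ B)).card =
      ((rookPlacements row col B k).sigma
        (fun S => E.filter (fun e => col e ∉ S.image col))).card := by
    symm
    refine Finset.card_bij (fun x _ => insert x.2 x.1) ?_ ?_ ?_
    · rintro ⟨S, e⟩ h
      simp only [Finset.mem_sigma, mem_rookPlacements, Finset.mem_filter] at h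
      obtain ⟨⟨⟨hSB, hSk⟩, hSr, hSc⟩, heE, hec⟩ := h
      have heS : e ∉ S := fun h => hB e (hSB h) (hE e heE)
      have heB : e ∉ B := fun h => hB e h (hE e heE)
      simp only [Finset.mem_filter, mem_rookPlacements]
      refine ⟨⟨⟨?_, ?_⟩, ?_, ?_⟩, ?_⟩
      · intro x hx
        rcases Finset.mem_insert.1 hx with rfl | hx
        · exact Finset.mem_union_right _ heE
        · exact Finset.mem_union_left _ (hSB hx)
      · rw [Finset.card_insert_of_notMem heS, hSk]
      · rw [Finset.coe_insert, Set.injOn_insert (by simpa using heS)]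
        refine ⟨hSr, ?_⟩
        rintro ⟨x, hx, hxe⟩
        exact hB x (hSB hx) (hxe.trans (hE e heE))
      · rw [Finset.coe_insert, Set.injOn_insert (by simpa using heS)]
        refine ⟨hSc, ?_⟩
        rintro ⟨x, hx, hxe⟩
        exact hec (Finset.mem_image.2 ⟨x, hx, hxe⟩)
      · exact fun h => heB (h (Finset.mem_insert_self _ _))
    · rintro ⟨S, e⟩ h ⟨S', e'⟩ h' heq
      simp only [Finset.mem_sigma, mem_rookPlacements, Finset.mem_filter] at h h'
      have hmem : ∀ x, x ∈ insert e S ↔ x ∈ insert e' S' := fun x => by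
        simp only at heq
        rw [heq]
      simp only [Finset.mem_insert] at hmem
      have hne : ∀ x ∈ S, row x ≠ s := fun x hx => hB x (h.1.1.1 hx)
      have hne' : ∀ x ∈ S', row x ≠ s := fun x hx => hB x (h'.1.1.1 hx)
      have he := hE e h.2.1
      have he' := hE e' h'.2.1
      have hee : e = e' := by
        rcases (hmem e).1 (Or.inl rfl) with h1 | h1
        · exact h1
        · exact absurd he (hne' e h1)
      subst hee
      have hSS : S = S' := by
        ext x
        constructor
        · intro hx
          rcases (hmem x).1 (Or.inr hx) with rfl | h1
          · exact absurd he (hne _ hx)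
          · exact h1
        · intro hx
          rcases (hmem x).2 (Or.inr hx) with rfl | h1
          · exact absurd he (hne' _ hx)
          · exact h1
      rw [hSS]
    · intro S hS
      simp only [Finset.mem_filter, mem_rookPlacements] at hS
      obtain ⟨⟨⟨hSB, hSk⟩, hSr, hSc⟩, hnot⟩ := hS
      obtain ⟨e, heS, heB⟩ := Finset.not_subset.1 hnot
      have heE : e ∈ E := (Finset.mem_union.1 (hSB heS)).resolve_left heB
      refine ⟨⟨S.erase e, e⟩, ?_, Finset.insert_erase heS⟩
      simp only [Finset.mem_sigma, mem_rookPlacements, Finset.mem_filter]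
      refine ⟨⟨⟨?_, ?_⟩, ?_, ?_⟩, heE, ?_⟩
      · intro x hx
        obtain ⟨hxe, hxS⟩ := Finset.mem_erase.1 hx
        refine (Finset.mem_union.1 (hSB hxS)).resolve_right fun hxE => hxe ?_
        exact hSr hxS heS ((hE x hxE).trans (hE e heE).symm)
      · rw [Finset.card_erase_of_mem heS, hSk]
        rfl
      · exact hSr.mono (by simp)
      · exact hSc.mono (by simp)
      · intro h
        obtain ⟨x, hx, hxe⟩ := Finset.mem_image.1 h
        obtain ⟨hne, hxS⟩ := Finset.mem_erase.1 hx
        exact hne (hSc hxS heS hxe)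
  rw [← Finset.card_filter_add_card_filter_not (s := rookPlacements row col (B ∪ E) (k + 1))
    (fun S => S ⊆ B), hold, hnew, Finset.card_sigma, add_assoc]
  congr 1
  rw [mul_comm k, mul_comm E.card, ← smul_eq_mul, ← smul_eq_mul, ← Finset.sum_const,
    ← Finset.sum_const, ← Finset.sum_add_distrib]
  exact Finset.sum_congr rfl hfree

/-- Rook numbers of a union of two boards sharing neither rows nor columns. -/
lemma card_rookPlacements_union {B C : Finset α}
    (hrow : ∀ b ∈ B, ∀ c ∈ C, row b ≠ row c) (hcol : ∀ b ∈ B, ∀ c ∈ C, col b ≠ col c) (k : ℕ) :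
    (rookPlacements row col (B ∪ C) k).card =
      ∑ ij ∈ Finset.HasAntidiagonal.antidiagonal k,
        (rookPlacements row col B ij.1).card * (rookPlacements row col C ij.2).card := by
  classical
  have hdisj : ∀ x ∈ B, x ∉ C := fun x hB hC => hrow x hB x hC rfl
  simp_rw [← Finset.card_product]
  rw [← Finset.card_sigma]
  symm
  refine Finset.card_bij (fun x _ => x.2.1 ∪ x.2.2) ?_ ?_ ?_
  · rintro ⟨⟨i, j⟩, S, T⟩ h
    simp only [Finset.mem_sigma, Finset.mem_product, mem_rookPlacements,
      Finset.HasAntidiagonal.mem_antidiagonal] at h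
    obtain ⟨hij, ⟨⟨hS, hSc⟩, hS1, hS2⟩, ⟨hT, hTc⟩, hT1, hT2⟩ := h
    have hST : Disjoint S T := Finset.disjoint_left.2 fun x h1 h2 => hdisj x (hS h1) (hT h2)
    rw [mem_rookPlacements]
    refine ⟨⟨Finset.union_subset_union hS hT, ?_⟩, ?_, ?_⟩
    · rw [Finset.card_union_of_disjoint hST, hSc, hTc, hij]
    · rw [Finset.coe_union, Set.injOn_union (by exact_mod_cast hST)]
      exact ⟨hS1, hT1, fun a ha b hb => hrow a (hS ha) b (hT hb)⟩
    · rw [Finset.coe_union, Set.injOn_union (by exact_mod_cast hST)]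
      exact ⟨hS2, hT2, fun a ha b hb => hcol a (hS ha) b (hT hb)⟩
  · rintro ⟨⟨i, j⟩, S, T⟩ h ⟨⟨i', j'⟩, S', T'⟩ h' heq
    simp only [Finset.mem_sigma, Finset.mem_product, mem_rookPlacements,
      Finset.HasAntidiagonal.mem_antidiagonal] at h h' heq
    obtain ⟨-, ⟨⟨hS, rfl⟩, -⟩, ⟨hT, rfl⟩, -⟩ := h
    obtain ⟨-, ⟨⟨hS', rfl⟩, -⟩, ⟨hT', rfl⟩, -⟩ := h'
    have hmem : ∀ x, x ∈ S ∪ T ↔ x ∈ S' ∪ T' := fun x => by rw [heq]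
    simp only [Finset.mem_union] at hmem
    have h1 : S = S' := by
      ext x
      have := hmem x
      have := @hS x
      have := @hT x
      have := @hS' x
      have := @hT' x
      have := hdisj x
      tauto
    have h2 : T = T' := by
      ext x
      have := hmem x
      have := @hS x
      have := @hT x
      have := @hS' x
      have := @hT' x
      have := hdisj x
      tauto
    rw [h1, h2]
  · intro S hS
    rw [mem_rookPlacements] at hS
    obtain ⟨⟨hSB, hSk⟩, h1, h2⟩ := hS
    have hun : S ∩ B ∪ S ∩ C = S := by
      rw [← Finset.inter_union_distrib_left, Finset.inter_eq_left.2 hSB]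
    refine ⟨⟨((S ∩ B).card, (S ∩ C).card), S ∩ B, S ∩ C⟩, ?_, hun⟩
    simp only [Finset.mem_sigma, Finset.mem_product, mem_rookPlacements, Finset.HasAntidiagonal.mem_antidiagonal]
    refine ⟨?_, ⟨⟨Finset.inter_subset_right, trivial⟩, h1.mono ?_, h2.mono ?_⟩,
      ⟨Finset.inter_subset_right, trivial⟩, h1.mono ?_, h2.mono ?_⟩
    · rw [← Finset.card_union_of_disjoint, hun, hSk]
      refine Finset.disjoint_left.2 fun x hx hx' => ?_
      exact hdisj x (Finset.mem_inter.1 hx).2 (Finset.mem_inter.1 hx').2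
    all_goals simp

end RookPlacements

section BishopBoard

/-- The number of nonattacking placements of `k` bishops on a set `B` of cells of `ℤ²`. -/
def bishopNumber (B : Finset (ℤ × ℤ)) (k : ℕ) : ℕ :=
  (rookPlacements (fun p : ℤ × ℤ => p.1 + p.2) (fun p : ℤ × ℤ => p.1 - p.2) B k).card

/-- The cells of the `n × n` board. -/
def boardCells (n : ℤ) : Finset (ℤ × ℤ) := Finset.Icc 1 n ×ˢ Finset.Icc 1 n

/-- The antidiagonal of the `n × n` board at signed distance `t` from the main one. -/
def antidiagonalCells (n t : ℤ) : Finset (ℤ × ℤ) :=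
  {p ∈ boardCells n | p.1 + p.2 - n - 1 = t}

/-- The antidiagonals of the `n × n` board having at most `v` cells, and a number of cells
congruent to `v` modulo 2. -/
def shortAntidiagonals (n v : ℤ) : Finset (ℤ × ℤ) :=
  {p ∈ boardCells n | n - |p.1 + p.2 - n - 1| ≤ v ∧ (v - (n - |p.1 + p.2 - n - 1|)) % 2 = 0}

lemma mem_boardCells {n : ℤ} {p : ℤ × ℤ} :
    p ∈ boardCells n ↔ (1 ≤ p.1 ∧ p.1 ≤ n) ∧ 1 ≤ p.2 ∧ p.2 ≤ n := by
  simp [boardCells]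

lemma not_bishopAttack_iff {p r : ℤ × ℤ} :
    ¬ bishopAttack p r ↔ p.1 + p.2 ≠ r.1 + r.2 ∧ p.1 - p.2 ≠ r.1 - r.2 := by
  obtain ⟨a, b⟩ := p
  obtain ⟨c, d⟩ := r
  simp only [bishopAttack, Prod.mk_sub_mk, Prod.mk.injEq, not_or, not_exists, not_and]
  constructor
  · rintro ⟨h1, h2⟩
    exact ⟨fun h => h2 (c - a) rfl (by omega), fun h => h1 (c - a) rfl (by omega)⟩
  · rintro ⟨h1, h2⟩
    exact ⟨fun k h => by omega, fun k h => by omega⟩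

lemma bishopCount_eq (q n : ℕ) : bishopCount q n = bishopNumber (boardCells n) q := by
  rw [bishopCount, bishopNumber, ← Nat.card_eq_finsetCard]
  refine Nat.card_congr (Equiv.subtypeEquivRight fun S => ?_)
  simp only [mem_rookPlacements, not_bishopAttack_iff, Set.InjOn, Finset.mem_coe,
    Finset.subset_iff, mem_boardCells]
  constructor
  · rintro ⟨h1, h2, h3⟩
    refine ⟨⟨fun p hp => ?_, h1⟩, fun p hp r hr h => ?_, fun p hp r hr h => ?_⟩
    · have := h2 p hp
      tauto
    · by_contra hne
      exact (h3 p hp r hr hne).1 h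
    · by_contra hne
      exact (h3 p hp r hr hne).2 h
  · rintro ⟨⟨h1, h2⟩, h3, h4⟩
    refine ⟨h2, fun p hp => ?_, fun p hp r hr hne => ⟨fun h => hne (h3 hp hr h),
      fun h => hne (h4 hp hr h)⟩⟩
    have := h1 hp
    tauto

lemma card_antidiagonalCells {n t : ℤ} (ht : |t| < n) :
    ((antidiagonalCells n t).card : ℤ) = n - |t| := by
  have h : antidiagonalCells n t =
      (Finset.Icc (max 1 (t + 1)) (min n (n + t))).image (fun x => (x, t + n + 1 - x)) := by
    ext ⟨x, y⟩
    simp only [antidiagonalCells, Finset.mem_filter, mem_boardCells, Finset.mem_image,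
      Finset.mem_Icc, Prod.mk.injEq]
    constructor
    · rintro ⟨h1, h2⟩
      exact ⟨x, by omega, rfl, by omega⟩
    · rintro ⟨x', h1, rfl, rfl⟩
      omega
  rw [h, Finset.card_image_of_injective _ fun x y hxy => (Prod.mk.inj hxy).1, Int.card_Icc]
  rcases abs_cases t with h | h <;> omega

/-- Bishop numbers after adding an antidiagonal at least as long as the previous ones. -/
lemma bishopNumber_union_antidiagonalCells {n t : ℤ} (ht : |t| < n) {B : Finset (ℤ × ℤ)}
    (hB : B ⊆ boardCells n)
    (hlen : ∀ p ∈ B, |t| ≤ |p.1 + p.2 - n - 1| ∧ p.1 + p.2 - n - 1 ≠ t ∧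
      (p.1 + p.2 - n - 1 - t) % 2 = 0) (k : ℕ) :
    (bishopNumber (B ∪ antidiagonalCells n t) (k + 1) : ℤ) =
      bishopNumber B (k + 1) + (n - |t| - k) * bishopNumber B k := by
  have key := card_rookPlacements_union_row (row := fun p : ℤ × ℤ => p.1 + p.2)
    (col := fun p : ℤ × ℤ => p.1 - p.2) (B := B) (E := antidiagonalCells n t) (s := t + n + 1)
    (by
      intro e he
      simp only [antidiagonalCells, Finset.mem_filter] at he
      omega)
    (by
      intro b hb
      have := hlen b hb
      omega)
    (by
      rintro ⟨x, y⟩ hb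
      have h1 := hlen _ hb
      have h2 := mem_boardCells.1 (hB hb)
      simp only at h1 h2
      refine ⟨((x - y + (t + n + 1)) / 2, t + n + 1 - (x - y + (t + n + 1)) / 2), ?_, ?_⟩
      · simp only [antidiagonalCells, Finset.mem_filter, mem_boardCells]
        rcases abs_cases t with h | h <;> rcases abs_cases (x + y - n - 1) with h' | h' <;> omega
      · simp only
        omega)
    (by
      rintro ⟨x, y⟩ h ⟨x', y'⟩ h' heq
      simp only [antidiagonalCells, Finset.coe_filter, Set.mem_ofPred_eq] at h h' heq
      ext <;> simp only <;> omega)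
    k
  have hc := card_antidiagonalCells ht
  simp only [bishopNumber]
  zify at key
  rw [hc] at key
  linear_combination key

lemma shortAntidiagonals_add_two {n v : ℤ} (hv : v + 2 ≤ n) :
    shortAntidiagonals n (v + 2) =
      shortAntidiagonals n v ∪ antidiagonalCells n (n - (v + 2)) ∪
        antidiagonalCells n (-(n - (v + 2))) := by
  ext ⟨x, y⟩
  simp only [shortAntidiagonals, antidiagonalCells, Finset.mem_union, Finset.mem_filter]
  by_cases hb : (x, y) ∈ boardCells n
  · simp only [hb, true_and]
    rcases abs_cases (x + y - n - 1) with h | h <;> omega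
  · simp [hb]

lemma boardCells_eq (n : ℤ) :
    boardCells n = shortAntidiagonals n n ∪ shortAntidiagonals n (n - 1) := by
  ext ⟨x, y⟩
  simp only [shortAntidiagonals, Finset.mem_union, Finset.mem_filter]
  by_cases hb : (x, y) ∈ boardCells n
  · simp only [hb, true_and, true_iff]
    have := mem_boardCells.1 hb
    rcases abs_cases (x + y - n - 1) with h | h <;> omega
  · simp [hb]

lemma shortAntidiagonals_eq_empty {n v : ℤ} (hv : v ≤ 0) : shortAntidiagonals n v = ∅ := by
  rw [Finset.eq_empty_iff_forall_notMem]
  rintro ⟨x, y⟩ h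
  simp only [shortAntidiagonals, Finset.mem_filter, mem_boardCells] at h
  rcases abs_cases (x + y - n - 1) with h' | h' <;> omega

lemma bishopNumber_boardCells (n : ℤ) (q : ℕ) :
    bishopNumber (boardCells n) q = ∑ ij ∈ Finset.HasAntidiagonal.antidiagonal q,
      bishopNumber (shortAntidiagonals n n) ij.1 *
        bishopNumber (shortAntidiagonals n (n - 1)) ij.2 := by
  rw [boardCells_eq, bishopNumber, card_rookPlacements_union]
  · rfl
  all_goals
    rintro ⟨x, y⟩ h ⟨x', y'⟩ h'
    simp only [shortAntidiagonals, Finset.mem_filter] at h h'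
    simp only
    rcases abs_cases (x + y - n - 1) with h1 | h1 <;>
      rcases abs_cases (x' + y' - n - 1) with h2 | h2 <;> omega

end BishopBoard

section RookPolynomials

open Polynomial

lemma exists_discrete_antiderivative (P : ℚ[X]) :
    ∃ Q : ℚ[X], Q.eval 0 = 0 ∧ ∀ x, Q.eval (x + 1) = Q.eval x + P.eval x := by
  induction P using Polynomial.induction_on' with
  | add P₁ P₂ h₁ h₂ =>
    obtain ⟨Q₁, h₁, h₁'⟩ := h₁
    obtain ⟨Q₂, h₂, h₂'⟩ := h₂
    refine ⟨Q₁ + Q₂, by simp [h₁, h₂], fun x => ?_⟩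
    simp only [eval_add, h₁', h₂']
    ring
  | monomial n a =>
    refine ⟨C (a / (n + 1)) * (Polynomial.bernoulli (n + 1) -
      C ((Polynomial.bernoulli (n + 1)).eval 0)), by simp, fun x => ?_⟩
    simp only [eval_mul, eval_sub, eval_C, eval_monomial, add_comm x 1,
      Polynomial.bernoulli_eval_one_add]
    have : (n + 1 : ℚ) ≠ 0 := by positivity
    field_simp
    rw [Nat.add_sub_cancel]
    push_cast
    ring

/-- The polynomials `σ i` whose values at natural numbers `M ≥ i` are the Stirling numbers of the
second kind `S(M, M - i)`. -/
def stirlingPoly : ℕ → ℚ[X]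
  | 0 => 1
  | i + 1 => Classical.choose (exists_discrete_antiderivative ((X - C (i : ℚ)) * stirlingPoly i))

lemma stirlingPoly_eval_zero (i : ℕ) : (stirlingPoly (i + 1)).eval 0 = 0 := by
  rw [stirlingPoly]
  exact (Classical.choose_spec
    (exists_discrete_antiderivative ((X - C (i : ℚ)) * stirlingPoly i))).1

lemma stirlingPoly_eval_add_one (i : ℕ) (x : ℚ) :
    (stirlingPoly (i + 1)).eval (x + 1) =
      (stirlingPoly (i + 1)).eval x + (x - i) * (stirlingPoly i).eval x := by
  have h := (Classical.choose_spec
    (exists_discrete_antiderivative ((X - C (i : ℚ)) * stirlingPoly i))).2 x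
  rw [stirlingPoly, h]
  simp

/-- The polynomials `(-1) ^ j * binom(X, j)`. -/
def signedChoosePoly : ℕ → ℚ[X]
  | 0 => 1
  | j + 1 => signedChoosePoly j * (C ((j + 1 : ℚ)⁻¹) * (C (j : ℚ) - X))

lemma signedChoosePoly_eval_succ (j : ℕ) (a : ℚ) :
    (signedChoosePoly (j + 1)).eval a = (signedChoosePoly j).eval a * ((j - a) / (j + 1)) := by
  simp only [signedChoosePoly, eval_mul, eval_C, eval_sub, eval_X]
  ring

lemma signedChoosePoly_eval_add_one (j : ℕ) (a : ℚ) :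
    (signedChoosePoly (j + 1)).eval (a + 1) =
      (signedChoosePoly (j + 1)).eval a - (signedChoosePoly j).eval a := by
  have h : (signedChoosePoly (j + 1)).eval (a + 1) =
      (signedChoosePoly j).eval a * ((-1 - a) / (j + 1)) := by
    induction j with
    | zero => simp [signedChoosePoly]; ring
    | succ j ih =>
      rw [signedChoosePoly_eval_succ, ih, signedChoosePoly_eval_succ]
      have h1 : (j + 1 : ℚ) ≠ 0 := by positivity
      have h2 : (j + 1 + 1 : ℚ) ≠ 0 := by positivity
      push_cast
      field_simp
      ring
  rw [h, signedChoosePoly_eval_succ]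
  have h1 : (j + 1 : ℚ) ≠ 0 := by positivity
  field_simp
  ring

/-- The `k`-th rook number of a Ferrers board with factorial polynomial `x ^ a * (x + 1) ^ b`,
as a function of rational `a` and `b`. -/
def rookValue (k : ℕ) (a b : ℚ) : ℚ :=
  ∑ ji ∈ Finset.HasAntidiagonal.antidiagonal k,
    (signedChoosePoly ji.1).eval a * (stirlingPoly ji.2).eval (a + b + 1 - ji.1)

lemma rookValue_zero (a b : ℚ) : rookValue 0 a b = 1 := by
  simp [rookValue, signedChoosePoly, stirlingPoly]

lemma rookValue_add_one_right (k : ℕ) (a b : ℚ) :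
    rookValue (k + 1) a (b + 1) = rookValue (k + 1) a b + (a + b + 1 - k) * rookValue k a b := by
  simp only [rookValue, Finset.Nat.sum_antidiagonal_succ', Finset.mul_sum]
  rw [add_assoc (_ * _) (∑ _ ∈ _, _), ← Finset.sum_add_distrib]
  congr 1
  · simp [stirlingPoly]
  refine Finset.sum_congr rfl fun ji h => ?_
  rw [Finset.HasAntidiagonal.mem_antidiagonal] at h
  rw [show a + (b + 1) + 1 - (ji.1 : ℚ) = (a + b + 1 - ji.1) + 1 by ring,
    stirlingPoly_eval_add_one, ← h]
  push_cast
  ring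

lemma rookValue_add_one_left' (k : ℕ) (a b : ℚ) :
    rookValue (k + 1) (a + 1) b = rookValue (k + 1) a (b + 1) - rookValue k a b := by
  simp only [rookValue, Finset.Nat.sum_antidiagonal_succ]
  rw [add_sub_assoc (_ * _) (∑ _ ∈ _, _), ← Finset.sum_sub_distrib]
  congr 1
  · simp only [signedChoosePoly, eval_one]
    ring_nf
  refine Finset.sum_congr rfl fun ji h => ?_
  rw [signedChoosePoly_eval_add_one]
  push_cast
  ring_nf

lemma rookValue_add_one_left (k : ℕ) (a b : ℚ) :
    rookValue (k + 1) (a + 1) b = rookValue (k + 1) a b + (a + b - k) * rookValue k a b := by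
  rw [rookValue_add_one_left', rookValue_add_one_right]
  ring

/-- The composition of `rookValue k` with two polynomials. -/
def rookPoly (k : ℕ) (f g : ℚ[X]) : ℚ[X] :=
  ∑ ji ∈ Finset.HasAntidiagonal.antidiagonal k,
    (signedChoosePoly ji.1).comp f * (stirlingPoly ji.2).comp (f + g + 1 - C (ji.1 : ℚ))

lemma eval_rookPoly (k : ℕ) (f g : ℚ[X]) (x : ℚ) :
    (rookPoly k f g).eval x = rookValue k (f.eval x) (g.eval x) := by
  simp [rookPoly, rookValue, eval_finsetSum, eval_comp]

/-- The value on the moment sequence `m` of the linear functional `y ^ j ↦ m j` at the rising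
factorial `y (y + 1) ⋯ (y + k - 1)`. -/
def risingMoment (m : ℕ → ℚ) (k : ℕ) : ℚ :=
  ∑ ji ∈ Finset.HasAntidiagonal.antidiagonal k, m ji.1 * (stirlingPoly ji.2).eval (-ji.1 : ℚ)

lemma risingMoment_zero (m : ℕ → ℚ) : risingMoment m 0 = m 0 := by
  simp [risingMoment, stirlingPoly]

lemma risingMoment_succ_eq (m : ℕ → ℚ) (k : ℕ) :
    risingMoment m (k + 1) =
      ∑ ji ∈ Finset.HasAntidiagonal.antidiagonal k, m (ji.1 + 1) * (stirlingPoly ji.2).eval (-(ji.1 + 1) : ℚ) := by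
  simp [risingMoment, Finset.Nat.sum_antidiagonal_succ, stirlingPoly_eval_zero]

lemma risingMoment_succ (m : ℕ → ℚ) (k : ℕ) :
    risingMoment m (k + 1) = k * risingMoment m k + risingMoment (fun j => m (j + 1)) k := by
  cases k with
  | zero =>
    rw [risingMoment_succ_eq, risingMoment_zero]
    simp [stirlingPoly, risingMoment_zero]
  | succ k =>
    rw [risingMoment_succ_eq, risingMoment_succ_eq, risingMoment,
      Finset.Nat.sum_antidiagonal_succ', Finset.Nat.sum_antidiagonal_succ', Finset.mul_sum,
      add_left_comm, ← Finset.sum_add_distrib]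
    congr 1
    · simp [stirlingPoly]
    refine Finset.sum_congr rfl fun ji h => ?_
    rw [Finset.HasAntidiagonal.mem_antidiagonal] at h
    have := stirlingPoly_eval_add_one ji.2 (-(ji.1 + 1))
    rw [show (-(ji.1 + 1) + 1 : ℚ) = -ji.1 by ring] at this
    rw [this, ← h]
    push_cast
    ring

lemma rookValue_eq_risingMoment (k : ℕ) {a b : ℚ} (hab : a + b = -1) :
    rookValue k a b = risingMoment (fun j => (signedChoosePoly j).eval a) k := by
  simp only [rookValue, risingMoment, hab]
  simp

lemma risingMoment_le {m m' : ℕ → ℚ} (h : ∀ j, m j ≤ m' j) (k : ℕ) :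
    risingMoment m k ≤ risingMoment m' k := by
  induction k generalizing m m' with
  | zero => simpa [risingMoment_zero] using h 0
  | succ k ih =>
    rw [risingMoment_succ, risingMoment_succ]
    have h1 := ih h
    have h2 := ih (m := fun j => m (j + 1)) (m' := fun j => m' (j + 1)) fun j => h (j + 1)
    gcongr

lemma risingMoment_const_one (k : ℕ) : risingMoment (fun _ => 1) k = k.factorial := by
  induction k with
  | zero => simp [risingMoment_zero]
  | succ k ih =>
    rw [risingMoment_succ, ih, Nat.factorial_succ]
    push_cast
    ring

lemma risingMoment_const_zero (k : ℕ) : risingMoment (fun _ => 0) k = 0 := by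
  simp [risingMoment]

lemma rookValue_neg_one_zero (k : ℕ) : rookValue k (-1) 0 = k.factorial := by
  rw [rookValue_eq_risingMoment k (by norm_num), ← risingMoment_const_one]
  congr 1
  ext j
  induction j with
  | zero => simp [signedChoosePoly]
  | succ j ih =>
    rw [signedChoosePoly_eval_succ, ih]
    have h1 : (j + 1 : ℚ) ≠ 0 := by positivity
    field_simp
    ring

lemma signedChoosePoly_succ_eval_zero (j : ℕ) : (signedChoosePoly (j + 1)).eval 0 = 0 := by
  induction j with
  | zero => simp [signedChoosePoly]
  | succ j ih => rw [signedChoosePoly_eval_succ, ih, zero_mul]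

lemma rookValue_succ_zero_neg_one (k : ℕ) : rookValue (k + 1) 0 (-1) = 0 := by
  rw [rookValue_eq_risingMoment _ (by norm_num), risingMoment_succ_eq]
  simp [signedChoosePoly_succ_eval_zero]

lemma rookValue_succ_zero_zero (k : ℕ) : rookValue (k + 1) 0 0 = 0 := by
  have h := rookValue_add_one_right k 0 (-1)
  rw [rookValue_succ_zero_neg_one] at h
  cases k with
  | zero => simpa using h
  | succ k => simpa [rookValue_succ_zero_neg_one] using h

lemma rookValue_succ_one_zero (k : ℕ) : rookValue (k + 1) 1 0 = 0 := by
  have h := rookValue_add_one_left k 0 0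
  rw [rookValue_succ_zero_zero] at h
  cases k with
  | zero => simpa using h
  | succ k => simpa [rookValue_succ_zero_zero] using h

/-- The common value of the two rook polynomials of the even boards, extrapolated to side `-1`. -/
def halfRook (k : ℕ) : ℚ := rookValue k (-1 / 2) (-1 / 2)

lemma halfRook_eq (k : ℕ) :
    halfRook k = risingMoment (fun j => (signedChoosePoly j).eval (-1 / 2)) k :=
  rookValue_eq_risingMoment k (by norm_num)

lemma signedChoosePoly_neg_half_nonneg (j : ℕ) : 0 ≤ (signedChoosePoly j).eval (-1 / 2 : ℚ) := by
  induction j with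
  | zero => simp [signedChoosePoly]
  | succ j ih =>
    rw [signedChoosePoly_eval_succ]
    refine mul_nonneg ih (div_nonneg ?_ (by positivity))
    have : (0 : ℚ) ≤ j := by positivity
    linarith

lemma signedChoosePoly_neg_half_succ_le (j : ℕ) :
    (signedChoosePoly (j + 1)).eval (-1 / 2 : ℚ) ≤ (signedChoosePoly j).eval (-1 / 2) := by
  rw [signedChoosePoly_eval_succ]
  refine mul_le_of_le_one_right (signedChoosePoly_neg_half_nonneg j) ?_
  rw [div_le_one (by positivity)]
  linarith

lemma halfRook_nonneg (k : ℕ) : 0 ≤ halfRook k := by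
  rw [halfRook_eq, ← risingMoment_const_zero k]
  exact risingMoment_le signedChoosePoly_neg_half_nonneg k

lemma halfRook_succ_le (k : ℕ) : halfRook (k + 1) ≤ (k + 1) * halfRook k := by
  rw [halfRook_eq, halfRook_eq, risingMoment_succ, add_mul, one_mul]
  gcongr
  exact risingMoment_le signedChoosePoly_neg_half_succ_le k

lemma halfRook_zero : halfRook 0 = 1 := rookValue_zero _ _

lemma halfRook_one : halfRook 1 = 1 / 2 := by
  simp [halfRook_eq, risingMoment_succ, risingMoment_zero, signedChoosePoly]
  norm_num

lemma halfRook_three : halfRook 3 = 39 / 16 := by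
  simp [halfRook_eq, risingMoment_succ, risingMoment_zero, signedChoosePoly]
  norm_num

lemma halfRook_add_le {c : ℚ} {k₀ : ℕ} (h₀ : halfRook k₀ ≤ c * k₀.factorial) (k : ℕ) :
    halfRook (k₀ + k) ≤ c * (k₀ + k).factorial := by
  induction k with
  | zero => simpa using h₀
  | succ k ih =>
    calc halfRook (k₀ + k + 1) ≤ ((k₀ + k : ℕ) + 1) * halfRook (k₀ + k) := halfRook_succ_le _
      _ ≤ ((k₀ + k : ℕ) + 1) * (c * (k₀ + k).factorial) := by gcongr
      _ = c * (k₀ + (k + 1)).factorial := by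
        rw [← add_assoc, Nat.factorial_succ]
        push_cast
        ring

lemma sum_antidiagonal_add_two (f : ℕ × ℕ → ℚ) (n : ℕ) :
    ∑ ij ∈ Finset.HasAntidiagonal.antidiagonal (n + 2), f ij =
      f (0, n + 2) + (f (n + 2, 0) +
        ∑ ij ∈ Finset.HasAntidiagonal.antidiagonal n, f (ij.1 + 1, ij.2 + 1)) := by
  rw [Finset.Nat.sum_antidiagonal_succ, Finset.Nat.sum_antidiagonal_succ']

lemma sum_factorial_mul_factorial_le (q : ℕ) :
    ∑ ij ∈ Finset.HasAntidiagonal.antidiagonal (q + 3), (ij.1.factorial * ij.2.factorial : ℚ) ≤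
      8 / 3 * (q + 3).factorial := by
  induction q with
  | zero => simp [Finset.Nat.sum_antidiagonal_succ, Nat.factorial]; norm_num
  | succ q ih =>
    set n := q + 3 with hn
    have hleft : ∑ ij ∈ Finset.HasAntidiagonal.antidiagonal (n + 1), (ij.1.factorial * ij.2.factorial : ℚ) =
        (n + 1).factorial + ∑ ij ∈ Finset.HasAntidiagonal.antidiagonal n,
          (ij.1 + 1) * (ij.1.factorial * ij.2.factorial : ℚ) := by
      rw [Finset.Nat.sum_antidiagonal_succ]
      simp [Nat.factorial_succ, mul_assoc]
    have hright : ∑ ij ∈ Finset.HasAntidiagonal.antidiagonal (n + 1), (ij.1.factorial * ij.2.factorial : ℚ) =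
        (n + 1).factorial + ∑ ij ∈ Finset.HasAntidiagonal.antidiagonal n,
          (ij.2 + 1) * (ij.1.factorial * ij.2.factorial : ℚ) := by
      rw [Finset.Nat.sum_antidiagonal_succ']
      simp [Nat.factorial_succ, mul_left_comm]
    have hsum : ∑ ij ∈ Finset.HasAntidiagonal.antidiagonal n, (ij.1 + 1) * (ij.1.factorial * ij.2.factorial : ℚ) +
        ∑ ij ∈ Finset.HasAntidiagonal.antidiagonal n, (ij.2 + 1) * (ij.1.factorial * ij.2.factorial : ℚ) =
        (n + 2) * ∑ ij ∈ Finset.HasAntidiagonal.antidiagonal n, (ij.1.factorial * ij.2.factorial : ℚ) := by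
      rw [← Finset.sum_add_distrib, Finset.mul_sum]
      refine Finset.sum_congr rfl fun ij h => ?_
      rw [Finset.HasAntidiagonal.mem_antidiagonal] at h
      rw [← h]
      push_cast
      ring
    have hf : ((n + 1).factorial : ℚ) = (n + 1) * n.factorial := by
      rw [Nat.factorial_succ]
      push_cast
      ring
    have hn3 : (3 : ℚ) ≤ n := by rw [hn]; push_cast; linarith [(Nat.cast_nonneg q : (0 : ℚ) ≤ q)]
    have hpos : (0 : ℚ) < n.factorial := by positivity
    have hmul := mul_le_mul_of_nonneg_left ih (show (0 : ℚ) ≤ n + 2 by linarith)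
    have hslack := mul_nonneg (sub_nonneg.2 hn3) hpos.le
    rw [show q + 1 + 3 = n + 1 by omega, hf]
    rw [hf] at hleft hright
    nlinarith

lemma sum_halfRook_mul_halfRook_lt {q : ℕ} (hq : 3 ≤ q) :
    ∑ ij ∈ Finset.HasAntidiagonal.antidiagonal q, halfRook ij.1 * halfRook ij.2 < q.factorial := by
  obtain ⟨d, rfl⟩ := Nat.exists_eq_add_of_le hq
  have htop : halfRook (3 + d) ≤ 13 / 32 * (3 + d).factorial :=
    halfRook_add_le (by rw [halfRook_three]; norm_num [Nat.factorial]) d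
  have hhalf : ∀ k, halfRook (k + 1) ≤ 1 / 2 * (k + 1).factorial := fun k => by
    rw [add_comm k]
    exact halfRook_add_le (by rw [halfRook_one]; norm_num) k
  have hfac := sum_factorial_mul_factorial_le d
  have hpos : (0 : ℚ) < (3 + d).factorial := by positivity
  rw [show d + 3 = d + 1 + 2 by omega, sum_antidiagonal_add_two] at hfac
  rw [show 3 + d = d + 1 + 2 by omega] at htop hpos ⊢
  rw [sum_antidiagonal_add_two]
  have hmid : ∑ ij ∈ Finset.HasAntidiagonal.antidiagonal (d + 1), halfRook (ij.1 + 1) * halfRook (ij.2 + 1) ≤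
      1 / 4 * ∑ ij ∈ Finset.HasAntidiagonal.antidiagonal (d + 1),
        ((ij.1 + 1).factorial * (ij.2 + 1).factorial : ℚ) := by
    rw [Finset.mul_sum]
    refine Finset.sum_le_sum fun ij _ => ?_
    calc _ ≤ (1 / 2 * (ij.1 + 1).factorial) * (1 / 2 * (ij.2 + 1).factorial : ℚ) :=
          mul_le_mul (hhalf _) (hhalf _) (halfRook_nonneg _) (by positivity)
      _ = _ := by ring
  simp only [Nat.factorial_zero, Nat.cast_one, one_mul, mul_one,
    halfRook_zero, add_assoc, Nat.reduceAdd] at *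
  linarith

end RookPolynomials

section Enumeration

open Polynomial

variable {n t v : ℤ} {B : Finset (ℤ × ℤ)} {a b : ℚ}

lemma bishopNumber_zero (B : Finset (ℤ × ℤ)) : bishopNumber B 0 = 1 :=
  card_rookPlacements_zero B

lemma bishopNumber_empty_succ (k : ℕ) : bishopNumber ∅ (k + 1) = 0 :=
  card_rookPlacements_empty k

lemma bishopNumber_union_eq_right (ht : |t| < n) (hB : B ⊆ boardCells n)
    (hlen : ∀ p ∈ B, |t| ≤ |p.1 + p.2 - n - 1| ∧ p.1 + p.2 - n - 1 ≠ t ∧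
      (p.1 + p.2 - n - 1 - t) % 2 = 0)
    (h : ∀ k, (bishopNumber B k : ℚ) = rookValue k a b)
    (hab : ((n - |t| : ℤ) : ℚ) = a + b + 1) (k : ℕ) :
    (bishopNumber (B ∪ antidiagonalCells n t) k : ℚ) = rookValue k a (b + 1) := by
  cases k with
  | zero => simp [bishopNumber_zero, rookValue_zero]
  | succ k =>
    have key : ((bishopNumber (B ∪ antidiagonalCells n t) (k + 1) : ℤ) : ℚ) = _ :=
      congrArg _ (bishopNumber_union_antidiagonalCells ht hB hlen k)
    rw [Int.cast_add, Int.cast_mul, Int.cast_sub, hab] at key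
    push_cast at key
    rw [key, h, h, rookValue_add_one_right]

lemma bishopNumber_union_eq_left (ht : |t| < n) (hB : B ⊆ boardCells n)
    (hlen : ∀ p ∈ B, |t| ≤ |p.1 + p.2 - n - 1| ∧ p.1 + p.2 - n - 1 ≠ t ∧
      (p.1 + p.2 - n - 1 - t) % 2 = 0)
    (h : ∀ k, (bishopNumber B k : ℚ) = rookValue k a b)
    (hab : ((n - |t| : ℤ) : ℚ) = a + b) (k : ℕ) :
    (bishopNumber (B ∪ antidiagonalCells n t) k : ℚ) = rookValue k (a + 1) b := by
  cases k with
  | zero => simp [bishopNumber_zero, rookValue_zero]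
  | succ k =>
    have key : ((bishopNumber (B ∪ antidiagonalCells n t) (k + 1) : ℤ) : ℚ) = _ :=
      congrArg _ (bishopNumber_union_antidiagonalCells ht hB hlen k)
    rw [Int.cast_add, Int.cast_mul, Int.cast_sub, hab] at key
    push_cast at key
    rw [key, h, h, rookValue_add_one_left]

lemma shortAntidiagonals_subset (n v : ℤ) : shortAntidiagonals n v ⊆ boardCells n :=
  Finset.filter_subset _ _

lemma antidiagonalCells_subset (n t : ℤ) : antidiagonalCells n t ⊆ boardCells n :=
  Finset.filter_subset _ _

lemma bishopNumber_shortAntidiagonals_add_two (hv : -1 ≤ v) (hvn : v + 2 < n)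
    (h : ∀ k, (bishopNumber (shortAntidiagonals n v) k : ℚ) = rookValue k a b)
    (hab : a + b = v + 1) (k : ℕ) :
    (bishopNumber (shortAntidiagonals n (v + 2)) k : ℚ) = rookValue k (a + 1) (b + 1) := by
  have habs : |n - (v + 2)| = n - (v + 2) := abs_of_pos (by omega)
  rw [shortAntidiagonals_add_two hvn.le]
  refine bishopNumber_union_eq_left ?_ ?_ ?_ (bishopNumber_union_eq_right ?_ ?_ ?_ h ?_) ?_ k
  · rw [abs_neg, habs]
    omega
  · exact Finset.union_subset (shortAntidiagonals_subset _ _) (antidiagonalCells_subset _ _)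
  · rintro ⟨x, y⟩ hp
    simp only [Finset.mem_union, shortAntidiagonals, antidiagonalCells, Finset.mem_filter] at hp
    dsimp only
    rw [abs_neg, habs]
    rcases abs_cases (x + y - n - 1) with h' | h' <;> omega
  · rw [habs]
    omega
  · exact shortAntidiagonals_subset _ _
  · rintro ⟨x, y⟩ hp
    simp only [shortAntidiagonals, Finset.mem_filter] at hp
    dsimp only
    rw [habs]
    rcases abs_cases (x + y - n - 1) with h' | h' <;> omega
  · rw [habs, hab]
    push_cast
    ring
  · rw [abs_neg, habs]
    push_cast
    linarith

lemma bishopNumber_shortAntidiagonals_self (hv : -1 ≤ v)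
    (h : ∀ k, (bishopNumber (shortAntidiagonals (v + 2) v) k : ℚ) = rookValue k a b)
    (hab : a + b = v + 1) (k : ℕ) :
    (bishopNumber (shortAntidiagonals (v + 2) (v + 2)) k : ℚ) = rookValue k a (b + 1) := by
  rw [shortAntidiagonals_add_two le_rfl, sub_self, neg_zero, Finset.union_assoc,
    Finset.union_self]
  refine bishopNumber_union_eq_right ?_ (shortAntidiagonals_subset _ _) ?_ h ?_ k
  · rw [abs_zero]
    omega
  · rintro ⟨x, y⟩ hp
    simp only [shortAntidiagonals, Finset.mem_filter] at hp
    dsimp only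
    rw [abs_zero]
    rcases abs_cases (x + y - (v + 2) - 1) with h' | h' <;> omega
  · rw [abs_zero, hab]
    push_cast
    ring

lemma bishopNumber_shortAntidiagonals_odd (j : ℕ) (hj : 2 * (j : ℤ) ≤ n) (k : ℕ) :
    (bishopNumber (shortAntidiagonals n (2 * j - 1)) k : ℚ) = rookValue k j j := by
  induction j generalizing k with
  | zero =>
    rw [shortAntidiagonals_eq_empty (by simp)]
    cases k with
    | zero => simp [bishopNumber_zero, rookValue_zero]
    | succ k => simp [bishopNumber_empty_succ, rookValue_succ_zero_zero]
  | succ j ih =>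
    push_cast at hj ⊢
    rw [show 2 * ((j : ℤ) + 1) - 1 = 2 * j - 1 + 2 by ring]
    refine bishopNumber_shortAntidiagonals_add_two (by omega) (by omega) (ih (by omega)) ?_ k
    push_cast
    ring

lemma bishopNumber_shortAntidiagonals_even (j : ℕ) (hj : 2 * (j : ℤ) < n) (k : ℕ) :
    (bishopNumber (shortAntidiagonals n (2 * j)) k : ℚ) = rookValue k (j + 1) j := by
  induction j generalizing k with
  | zero =>
    rw [shortAntidiagonals_eq_empty (by simp)]
    cases k with
    | zero => simp [bishopNumber_zero, rookValue_zero]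
    | succ k => simp [bishopNumber_empty_succ, rookValue_succ_one_zero]
  | succ j ih =>
    push_cast at hj ⊢
    rw [show 2 * ((j : ℤ) + 1) = 2 * j + 2 by ring]
    refine bishopNumber_shortAntidiagonals_add_two (by omega) (by omega) (ih (by omega)) ?_ k
    push_cast
    ring

lemma bishopCount_even (q m : ℕ) :
    (bishopCount q (2 * (m + 1)) : ℚ) = ∑ ij ∈ Finset.HasAntidiagonal.antidiagonal q,
      rookValue ij.1 (m + 1) (m + 1) * rookValue ij.2 (m + 1) (m + 1) := by
  rw [bishopCount_eq, bishopNumber_boardCells]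
  push_cast
  refine Finset.sum_congr rfl fun ij _ => ?_
  have hodd := bishopNumber_shortAntidiagonals_odd (n := 2 * ((m : ℤ) + 1)) (m + 1)
    (by push_cast; omega) ij.2
  have heven := bishopNumber_shortAntidiagonals_self (v := 2 * m) (by omega)
    (bishopNumber_shortAntidiagonals_even m (by omega)) (by push_cast; ring) ij.1
  push_cast at hodd
  rw [hodd, show 2 * ((m : ℤ) + 1) = 2 * m + 2 by ring, heven]

lemma bishopCount_odd (q m : ℕ) :
    (bishopCount q (2 * m + 1) : ℚ) = ∑ ij ∈ Finset.HasAntidiagonal.antidiagonal q,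
      rookValue ij.1 m (m + 1) * rookValue ij.2 (m + 1) m := by
  rw [bishopCount_eq, bishopNumber_boardCells]
  push_cast
  refine Finset.sum_congr rfl fun ij _ => ?_
  have heven := bishopNumber_shortAntidiagonals_even (n := 2 * (m : ℤ) + 1) m (by omega) ij.2
  have hodd := bishopNumber_shortAntidiagonals_self (v := 2 * m - 1) (by omega)
    (bishopNumber_shortAntidiagonals_odd m (by omega)) (by push_cast; ring) ij.1
  rw [show 2 * (m : ℤ) - 1 + 2 = 2 * m + 1 by ring] at hodd
  rw [hodd, add_sub_cancel_right, heven]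

/-- The polynomial counting bishop placements on boards of even side. -/
def evenBishopPoly (q : ℕ) : ℚ[X] :=
  ∑ ij ∈ Finset.HasAntidiagonal.antidiagonal q,
    rookPoly ij.1 (C (1 / 2) * X) (C (1 / 2) * X) * rookPoly ij.2 (C (1 / 2) * X) (C (1 / 2) * X)

/-- The polynomial counting bishop placements on boards of odd side. -/
def oddBishopPoly (q : ℕ) : ℚ[X] :=
  ∑ ij ∈ Finset.HasAntidiagonal.antidiagonal q,
    rookPoly ij.1 (C (1 / 2) * (X - 1)) (C (1 / 2) * (X + 1)) *
      rookPoly ij.2 (C (1 / 2) * (X + 1)) (C (1 / 2) * (X - 1))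

lemma bishopCount_eq_evenBishopPoly (q : ℕ) {n : ℕ} (hn : 1 ≤ n) (he : Even n) :
    (bishopCount q n : ℚ) = (evenBishopPoly q).eval (n : ℚ) := by
  obtain ⟨m, rfl⟩ : ∃ m, n = 2 * (m + 1) := by
    obtain ⟨r, rfl⟩ := he
    exact ⟨r - 1, by omega⟩
  rw [bishopCount_even, evenBishopPoly, eval_finsetSum]
  refine Finset.sum_congr rfl fun ij _ => ?_
  rw [eval_mul, eval_rookPoly, eval_rookPoly, eval_mul, eval_C, eval_X]
  push_cast
  ring_nf

lemma bishopCount_eq_oddBishopPoly (q : ℕ) {n : ℕ} (ho : Odd n) :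
    (bishopCount q n : ℚ) = (oddBishopPoly q).eval (n : ℚ) := by
  obtain ⟨m, rfl⟩ := ho
  rw [bishopCount_odd, oddBishopPoly, eval_finsetSum]
  refine Finset.sum_congr rfl fun ij _ => ?_
  rw [eval_mul, eval_rookPoly, eval_rookPoly, eval_mul, eval_mul, eval_C, eval_add, eval_sub,
    eval_X, eval_one]
  push_cast
  ring_nf

lemma evenBishopPoly_eval_neg_one (q : ℕ) :
    (evenBishopPoly q).eval (-1) =
      ∑ ij ∈ Finset.HasAntidiagonal.antidiagonal q, halfRook ij.1 * halfRook ij.2 := by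
  rw [evenBishopPoly, eval_finsetSum]
  refine Finset.sum_congr rfl fun ij _ => ?_
  rw [eval_mul, eval_rookPoly, eval_rookPoly, eval_mul, eval_C, eval_X, halfRook, halfRook]
  norm_num

lemma oddBishopPoly_eval_neg_one (q : ℕ) : (oddBishopPoly q).eval (-1) = q.factorial := by
  rw [oddBishopPoly, eval_finsetSum]
  have h : ∀ ij ∈ Finset.HasAntidiagonal.antidiagonal q,
      (rookPoly ij.1 (C (1 / 2) * (X - 1)) (C (1 / 2) * (X + 1)) *
        rookPoly ij.2 (C (1 / 2) * (X + 1)) (C (1 / 2) * (X - 1)) : ℚ[X]).eval (-1) =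
      ij.1.factorial * rookValue ij.2 0 (-1) := by
    intro ij _
    rw [eval_mul, eval_rookPoly, eval_rookPoly, eval_mul, eval_mul, eval_C, eval_add, eval_sub,
      eval_X, eval_one, ← rookValue_neg_one_zero]
    norm_num
  rw [Finset.sum_congr rfl h, Finset.sum_eq_single (q, 0)]
  · rw [rookValue_zero, mul_one]
  · rintro ⟨i, j⟩ hij hne
    rw [Finset.HasAntidiagonal.mem_antidiagonal] at hij
    cases j with
    | zero => exact absurd (congrArg (fun i => (i, 0)) hij) hne
    | succ j => rw [rookValue_succ_zero_neg_one, mul_zero]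
  · simp

lemma eq_of_eval_linear_eq {P Q : ℚ[X]} (c : ℕ)
    (h : ∀ m : ℕ, P.eval (2 * m + c : ℚ) = Q.eval (2 * m + c : ℚ)) : P = Q := by
  refine Polynomial.eq_of_infinite_eval_eq P Q ?_
  refine Set.Infinite.mono (s := Set.range fun m : ℕ => (2 * m + c : ℚ)) ?_ ?_
  · rintro _ ⟨m, rfl⟩
    exact h m
  · refine Set.infinite_range_of_injective fun x y hxy => ?_
    simpa using hxy

end Enumeration

/-- For `q ≥ 3`, the bishops counting function is a quasipolynomial of period exactly 2. -/
theorem bishops_period_two (q : ℕ) (hq : 3 ≤ q) :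
    ∃ p₀ p₁ : Polynomial ℚ,
      (∀ n : ℕ, 1 ≤ n → Even n → (bishopCount q n : ℚ) = p₀.eval (n : ℚ)) ∧
      (∀ n : ℕ, 1 ≤ n → Odd n → (bishopCount q n : ℚ) = p₁.eval (n : ℚ)) ∧
      ¬ ∃ p : Polynomial ℚ, ∀ n : ℕ, 1 ≤ n → (bishopCount q n : ℚ) = p.eval (n : ℚ) := by
  refine ⟨evenBishopPoly q, oddBishopPoly q,
    fun n hn he => bishopCount_eq_evenBishopPoly q hn he,
    fun n _ ho => bishopCount_eq_oddBishopPoly q ho, ?_⟩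
  rintro ⟨p, hp⟩
  have h₀ : p = evenBishopPoly q := by
    refine eq_of_eval_linear_eq 2 fun m => ?_
    have h := hp (2 * m + 2) (by omega)
    rw [bishopCount_eq_evenBishopPoly q (by omega) ⟨m + 1, by ring⟩] at h
    exact_mod_cast h.symm
  have h₁ : p = oddBishopPoly q := by
    refine eq_of_eval_linear_eq 1 fun m => ?_
    have h := hp (2 * m + 1) (by omega)
    rw [bishopCount_eq_oddBishopPoly q ⟨m, rfl⟩] at h
    exact_mod_cast h.symm
  have hlt := sum_halfRook_mul_halfRook_lt hq
  rw [← evenBishopPoly_eval_neg_one, ← h₀, h₁, oddBishopPoly_eval_neg_one] at hlt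
  exact lt_irrefl _ hlt

end
end

section
/- Let B = [0,1]² and let ℙ be a piece with basic moves m₁ = (c₁, d₁) and m₂ = (c₂, d₂), where c₁, d₁, c₂, d₂ are positive integers with gcd(c₁,d₁) = gcd(c₂,d₂) = 1 and 0 < d₁/c₁ < 1 < d₂/c₂. Put t = (d₁c₂)/(c₁d₂) and D = c₁d₂ − c₂d₁. Define for i ≥ 1 the rational points A_i = (1, t^{(i−1)/2}) for i odd and A_i = ((d₁/c₁)·t^{i/2−1}, (c₂/d₂)·t^{i/2−1}) for i even, and the rational points G_i = t^{(i−1)/2}·(c₂(d₁−c₁)/D, d₁(d₂−c₂)/D) for i odd and G_i = t^{i/2}·(c₁(c₂−d₂)/D, d₂(c₁−d₁)/D) for i even. Then for every q ≥ 1 the denominator D(B^q, A_ℙ^q) of the inside-out polytope equals the least common multiple of the denominators of the points A₁,…,A_q together with the denominators of the points G₁,…,G_{⌊(q−1)/2⌋}. -/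
noncomputable section

/-- The ratio `t = (d₁ c₂)/(c₁ d₂)`. -/
def tRatio (c₁ d₁ c₂ d₂ : ℤ) : ℚ := ((d₁ * c₂ : ℤ) : ℚ) / ((c₁ * d₂ : ℤ) : ℚ)

/-- The points of the corner trajectories:
`A_i = (1, t^{(i-1)/2})` for `i` odd and
`A_i = ((d₁/c₁) t^{i/2-1}, (c₂/d₂) t^{i/2-1})` for `i` even. -/
def Apt (c₁ d₁ c₂ d₂ : ℤ) (i : ℕ) : ℚ × ℚ :=
  if i % 2 = 1 then
    (1, tRatio c₁ d₁ c₂ d₂ ^ ((i - 1) / 2))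
  else
    (((d₁ : ℚ) / (c₁ : ℚ)) * tRatio c₁ d₁ c₂ d₂ ^ (i / 2 - 1),
     ((c₂ : ℚ) / (d₂ : ℚ)) * tRatio c₁ d₁ c₂ d₂ ^ (i / 2 - 1))

/-- The crossing points:
`G_i = t^{(i-1)/2} (c₂(d₁-c₁)/D, d₁(d₂-c₂)/D)` for `i` odd and
`G_i = t^{i/2} (c₁(c₂-d₂)/D, d₂(c₁-d₁)/D)` for `i` even, where `D = c₁d₂ - c₂d₁`. -/
def Gpt (c₁ d₁ c₂ d₂ : ℤ) (i : ℕ) : ℚ × ℚ :=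
  if i % 2 = 1 then
    (tRatio c₁ d₁ c₂ d₂ ^ ((i - 1) / 2) *
       (((c₂ * (d₁ - c₁) : ℤ) : ℚ) / ((c₁ * d₂ - c₂ * d₁ : ℤ) : ℚ)),
     tRatio c₁ d₁ c₂ d₂ ^ ((i - 1) / 2) *
       (((d₁ * (d₂ - c₂) : ℤ) : ℚ) / ((c₁ * d₂ - c₂ * d₁ : ℤ) : ℚ)))
  else
    (tRatio c₁ d₁ c₂ d₂ ^ (i / 2) *
       (((c₁ * (c₂ - d₂) : ℤ) : ℚ) / ((c₁ * d₂ - c₂ * d₁ : ℤ) : ℚ)),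
     tRatio c₁ d₁ c₂ d₂ ^ (i / 2) *
       (((d₂ * (c₁ - d₁) : ℤ) : ℚ) / ((c₁ * d₂ - c₂ * d₁ : ℤ) : ℚ)))

/-- The denominator of a rational point of the plane. -/
def ptDenQ (p : ℚ × ℚ) : ℕ := Nat.lcm p.1.den p.2.den

/-- The linear form `α x + y`, constant along lines of slope `-α`. -/
def level (α : ℝ) (z : Pt) : ℝ := α * z.1 + z.2

/-- The reflection of the unit square in its centre. -/
def reflect (z : Pt) : Pt := (1 - z.1, 1 - z.2)

/-- `W` satisfies every attack and fixation equation satisfied by `Z`, for a piece attacking along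
the level lines of `α x + y` and `x + β y`. -/
structure Compat {ι : Type*} (α β : ℝ) (Z W : ι → Pt) : Prop where
  fst : ∀ i j, level α (Z i) = level α (Z j) → level α (W i) = level α (W j)
  snd : ∀ i j, level β (Z i).swap = level β (Z j).swap →
    level β (W i).swap = level β (W j).swap
  left : ∀ i, (Z i).1 = 0 → (W i).1 = 0
  right : ∀ i, (Z i).1 = 1 → (W i).1 = 1
  bot : ∀ i, (Z i).2 = 0 → (W i).2 = 0
  top : ∀ i, (Z i).2 = 1 → (W i).2 = 1

/-- `Z` is the only solution of its attack and fixation equations. -/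
def Rigid {ι : Type*} (α β : ℝ) (Z : ι → Pt) : Prop := ∀ W, Compat α β Z W → W = Z

/-- The configuration lies in the unit square. -/
def InSquare {ι : Type*} (Z : ι → Pt) : Prop :=
  ∀ i, 0 ≤ (Z i).1 ∧ (Z i).1 ≤ 1 ∧ 0 ≤ (Z i).2 ∧ (Z i).2 ≤ 1

theorem Compat.swap {ι : Type*} {α β : ℝ} {Z W : ι → Pt} (h : Compat α β Z W) :
    Compat β α (fun i => (Z i).swap) (fun i => (W i).swap) :=
  ⟨h.snd, h.fst, h.bot, h.top, h.left, h.right⟩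

theorem Rigid.swap {ι : Type*} {α β : ℝ} {Z : ι → Pt} (h : Rigid α β Z) :
    Rigid β α (fun i => (Z i).swap) := by
  intro W hW
  have := h _ hW.swap
  funext i
  rw [← congrFun this i, Prod.swap_swap]

/-- A positive function, homogeneous under scaling by `t`, equal to `1` on `(t s, s]`. -/
theorem exists_homogeneous {t s : ℝ} (ht0 : 0 < t) (ht1 : t < 1) (hs : 0 < s) :
    ∃ φ : ℝ → ℝ, (∀ x, 0 < x → 0 < φ x) ∧ (∀ x, 0 < x → φ (t * x) = t * φ x) ∧
      ∀ x, t * s < x → x ≤ s → φ x = 1 := by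
  refine ⟨fun x => t ^ ⌊Real.logb t (x / s)⌋, fun x _ => by positivity, fun x hx => ?_,
    fun x hx hxs => ?_⟩
  · have : Real.logb t (t * x / s) = Real.logb t (x / s) + 1 := by
      rw [mul_div_assoc, Real.logb_mul ht0.ne' (by positivity),
        Real.logb_self_eq_one_iff.2 ⟨ht0.ne', ht1.ne, by linarith⟩]
      ring
    simp only [this, Int.floor_add_one]
    rw [zpow_add_one₀ ht0.ne', mul_comm]
  · have hx0 : 0 < x := lt_trans (by positivity) hx
    have : ⌊Real.logb t (x / s)⌋ = 0 := by
      rw [Int.floor_eq_zero_iff]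
      constructor
      · rw [Real.logb_nonneg_iff_of_base_lt_one ht0 ht1 (by positivity)]
        exact (div_le_one hs).2 hxs
      · rw [Real.logb_lt_iff_lt_rpow_of_base_lt_one ht0 ht1 (by positivity), Real.rpow_one,
          lt_div_iff₀ hs]
        exact hx
    simp only [this, zpow_zero]

/-- Infinitesimal motions `f`, `g` of the two families of lines which move all points of the open
sides of the square along these sides. -/
theorem exists_motion {α β : ℝ} (hα0 : 0 < α) (hα1 : α < 1) (hβ0 : 0 < β) (hβ1 : β < 1) :
    ∃ f g : ℝ → ℝ, (∀ u, 0 < u → u < 1 + α → f u ≠ 0) ∧ (∀ v, 0 < v → v < 1 + β → g v ≠ 0) ∧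
      (∀ x, 0 < x → x < 1 → f (α * x) = α * g x) ∧
      (∀ y, 0 < y → y < 1 → g (β * y) = β * f y) ∧
      (∀ u, 0 < u → u < 1 → f (1 + α - u) = f u) ∧
      (∀ v, 0 < v → v < 1 → g (1 + β - v) = g v) := by
  have ht1 : α * β < 1 := by nlinarith
  obtain ⟨φ, hpos, hhom, hone⟩ :=
    exists_homogeneous (t := α * β) (s := 1 / α) (by positivity) ht1 (by positivity)
  have hts : α * β * (1 / α) = β := by field_simp
  rw [hts] at hone
  refine ⟨fun u => if u < 1 then α * φ (u / α) else α * φ ((1 + α - u) / α),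
    fun v => if v < 1 then φ v else φ (1 + β - v), ?_, ?_, ?_, ?_, ?_, ?_⟩
  · intro u h0 h1
    dsimp only
    split_ifs
    · exact (mul_pos hα0 (hpos _ (by positivity))).ne'
    · exact (mul_pos hα0 (hpos _ (div_pos (by linarith) hα0))).ne'
  · intro v h0 h1
    dsimp only
    split_ifs
    · exact (hpos _ h0).ne'
    · exact (hpos _ (by linarith)).ne'
  · intro x h0 h1
    have : α * x < 1 := by nlinarith
    simp only [this, h1, if_true]
    rw [mul_div_cancel_left₀ _ hα0.ne']
  · intro y h0 h1
    have : β * y < 1 := by nlinarith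
    simp only [this, h1, if_true]
    have h2 : β * y = α * β * (y / α) := by field_simp
    rw [h2, hhom _ (by positivity)]
    ring
  · intro u h0 h1
    by_cases hu : u ≤ α
    · have : ¬ (1 + α - u < 1) := by linarith
      simp only [this, h1, if_true, if_false]
      congr 3
      ring
    · have : 1 + α - u < 1 := by linarith
      simp only [this, h1, if_true]
      rw [hone, hone]
      · rw [lt_div_iff₀ hα0]; nlinarith
      · gcongr
      · rw [lt_div_iff₀ hα0]; nlinarith
      · gcongr
  · intro v h0 h1
    have hs : 1 ≤ 1 / α := by rw [le_div_iff₀ hα0]; linarith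
    by_cases hv : v ≤ β
    · have : ¬ (1 + β - v < 1) := by linarith
      simp only [this, h1, if_true, if_false]
      congr 1
      ring
    · have : 1 + β - v < 1 := by linarith
      simp only [this, h1, if_true]
      rw [hone, hone]
      all_goals linarith

open Classical in
/-- If `S₁` and `S₂` are sets of lines of the two families containing the lines through occupied
corners, and containing or avoiding simultaneously the two lines through an occupied boundary
point, then in a rigid configuration they contain every occupied line. -/
theorem Rigid.mem_of_closed {ι : Type*} {α β : ℝ} {Z : ι → Pt} (hZ : Rigid α β Z)
    (hsq : InSquare Z) (hα0 : 0 < α) (hα1 : α < 1) (hβ0 : 0 < β) (hβ1 : β < 1)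
    (S₁ S₂ : ℝ → Prop)
    (hcorner : ∀ i, ((Z i).1 = 0 ∨ (Z i).1 = 1) → ((Z i).2 = 0 ∨ (Z i).2 = 1) →
      S₁ (level α (Z i)) ∧ S₂ (level β (Z i).swap))
    (hside : ∀ i, ((Z i).1 = 0 ∨ (Z i).1 = 1 ∨ (Z i).2 = 0 ∨ (Z i).2 = 1) →
      (S₁ (level α (Z i)) ↔ S₂ (level β (Z i).swap))) (i : ι) :
    S₁ (level α (Z i)) ∧ S₂ (level β (Z i).swap) := by
  obtain ⟨f, g, hf0, hg0, hx, hy, hf, hg⟩ := exists_motion hα0 hα1 hβ0 hβ1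
  have ht : 1 - α * β ≠ 0 := by nlinarith
  let du : ι → ℝ := fun i => if S₁ (level α (Z i)) then 0 else f (level α (Z i))
  let dv : ι → ℝ := fun i => if S₂ (level β (Z i).swap) then 0 else g (level β (Z i).swap)
  let W : ι → Pt := fun i => ((Z i).1 + (dv i - β * du i) / (1 - α * β),
    (Z i).2 + (du i - α * dv i) / (1 - α * β))
  have hWu : ∀ i, level α (W i) = level α (Z i) + du i := by
    intro i
    simp only [W, level]
    linear_combination mul_div_cancel_right₀ (du i) ht
  have hWv : ∀ i, level β (W i).swap = level β (Z i).swap + dv i := by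
    intro i
    simp only [W, level, Prod.swap]
    linear_combination mul_div_cancel_right₀ (dv i) ht
  have hsideX : ∀ i, ((Z i).1 = 0 ∨ (Z i).1 = 1) → dv i = β * du i := by
    intro i hi
    have hS := hside i (by tauto)
    by_cases h : S₂ (level β (Z i).swap)
    · simp [du, dv, h, hS]
    have hc : ¬ ((Z i).2 = 0 ∨ (Z i).2 = 1) := fun hc => h (hcorner i hi hc).2
    push Not at hc
    obtain ⟨-, -, h0, h1⟩ := hsq i
    have h0 := lt_of_le_of_ne h0 (Ne.symm hc.1)
    have h1 := lt_of_le_of_ne h1 hc.2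
    simp only [du, dv, h, hS, if_false]
    rcases hi with hi | hi
    · simpa [level, hi] using hy _ h0 h1
    · have e1 : level α (Z i) = 1 + α - (1 - (Z i).2) := by simp only [level, hi]; ring
      have e2 : level β (Z i).swap = 1 + β - β * (1 - (Z i).2) := by
        simp only [level, hi, Prod.swap]; ring
      rw [e1, e2, hf _ (by linarith) (by linarith), hg _ (by nlinarith) (by nlinarith),
        hy _ (by linarith) (by linarith)]
  have hsideY : ∀ i, ((Z i).2 = 0 ∨ (Z i).2 = 1) → du i = α * dv i := by
    intro i hi
    have hS := hside i (by tauto)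
    by_cases h : S₂ (level β (Z i).swap)
    · simp [du, dv, h, hS]
    have hc : ¬ ((Z i).1 = 0 ∨ (Z i).1 = 1) := fun hc => h (hcorner i hc hi).2
    push Not at hc
    obtain ⟨h0, h1, -, -⟩ := hsq i
    have h0 := lt_of_le_of_ne h0 (Ne.symm hc.1)
    have h1 := lt_of_le_of_ne h1 hc.2
    simp only [du, dv, h, hS, if_false]
    rcases hi with hi | hi
    · simpa [level, hi] using hx _ h0 h1
    · have e1 : level α (Z i) = 1 + α - α * (1 - (Z i).1) := by simp only [level, hi]; ring
      have e2 : level β (Z i).swap = 1 + β - (1 - (Z i).1) := by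
        simp only [level, hi, Prod.swap]; ring
      rw [e1, e2, hf _ (by nlinarith) (by nlinarith), hg _ (by linarith) (by linarith),
        hx _ (by linarith) (by linarith)]
  have hW : Compat α β Z W := by
    refine ⟨fun i j h => ?_, fun i j h => ?_, fun i h => ?_, fun i h => ?_, fun i h => ?_,
      fun i h => ?_⟩
    · rw [hWu, hWu]; simp only [du, h]
    · rw [hWv, hWv]; simp only [dv, h]
    · simp [W, hsideX i (Or.inl h), h]
    · simp [W, hsideX i (Or.inr h), h]
    · simp [W, hsideY i (Or.inl h), h]
    · simp [W, hsideY i (Or.inr h), h]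
  have hEq := hZ W hW
  have hu := hWu i
  have hv := hWv i
  rw [hEq, left_eq_add] at hu hv
  obtain ⟨hx0, hx1, hy0, hy1⟩ := hsq i
  by_cases hlow : (Z i).1 = 0 ∧ (Z i).2 = 0
  · exact hcorner i (Or.inl hlow.1) (Or.inl hlow.2)
  by_cases hhigh : (Z i).1 = 1 ∧ (Z i).2 = 1
  · exact hcorner i (Or.inr hhigh.1) (Or.inr hhigh.2)
  have hlow : 0 < (Z i).1 ∨ 0 < (Z i).2 := by
    by_contra! h
    exact hlow ⟨by linarith, by linarith⟩
  have hhigh : (Z i).1 < 1 ∨ (Z i).2 < 1 := by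
    by_contra! h
    exact hhigh ⟨by linarith, by linarith⟩
  constructor
  · by_contra h
    simp only [du, h, if_false] at hu
    refine hf0 _ ?_ ?_ hu
    · simp only [level]; rcases hlow with h | h <;> nlinarith
    · simp only [level]; rcases hhigh with h | h <;> nlinarith
  · by_contra h
    simp only [dv, h, if_false] at hv
    refine hg0 _ ?_ ?_ hv
    · simp only [level, Prod.swap]; rcases hlow with h | h <;> nlinarith
    · simp only [level, Prod.swap]; rcases hhigh with h | h <;> nlinarith

/-- The points on the axes obtained from `(1, 0)` by moving alternately along level lines of
`α x + y` and `x + β y`. -/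
def chainPt (α β : ℝ) (n : ℕ) : Pt :=
  if n % 2 = 0 then ((α * β) ^ (n / 2), 0) else (0, α * (α * β) ^ (n / 2))

/-- The crossings of the lines leaving the `n`-th points of the chains starting at `(1, 0)` and
`(0, 1)`. -/
def crossPt (α β : ℝ) (n : ℕ) : Pt :=
  if n % 2 = 0 then
    ((α * β) ^ (n / 2) * (β * (1 - α)) / (1 - α * β),
      (α * β) ^ (n / 2) * (α * (1 - β)) / (1 - α * β))
  else
    ((α * β) ^ (n / 2 + 1) * (1 - β) / (1 - α * β),
      (α * β) ^ (n / 2 + 1) * (1 - α) / (1 - α * β))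

theorem chainPt_even (α β : ℝ) (k : ℕ) : chainPt α β (2 * k) = ((α * β) ^ k, 0) := by
  simp [chainPt]

theorem chainPt_odd (α β : ℝ) (k : ℕ) : chainPt α β (2 * k + 1) = (0, α * (α * β) ^ k) := by
  have h : (2 * k + 1) / 2 = k := by omega
  simp [chainPt, h, Nat.add_mod]

theorem crossPt_even (α β : ℝ) (k : ℕ) : crossPt α β (2 * k) =
    ((α * β) ^ k * (β * (1 - α)) / (1 - α * β), (α * β) ^ k * (α * (1 - β)) / (1 - α * β)) := by
  simp [crossPt]

theorem crossPt_odd (α β : ℝ) (k : ℕ) : crossPt α β (2 * k + 1) =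
    ((α * β) ^ (k + 1) * (1 - β) / (1 - α * β), (α * β) ^ (k + 1) * (1 - α) / (1 - α * β)) := by
  have h : (2 * k + 1) / 2 = k := by omega
  simp [crossPt, h, Nat.add_mod]

theorem crossPt_swap (α β : ℝ) (n : ℕ) : (crossPt α β n).swap = crossPt β α n := by
  obtain ⟨k, rfl | rfl⟩ := n.even_or_odd'
  · simp [crossPt_even, mul_comm β α]
  · simp [crossPt_odd, mul_comm β α]

theorem level_reflect (α : ℝ) (z : Pt) : level α (reflect z) = 1 + α - level α z := by
  simp only [level, reflect]; ring

theorem reflect_reflect (z : Pt) : reflect (reflect z) = z := by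
  simp [reflect]

theorem InSquare.swap {ι : Type*} {Z : ι → Pt} (h : InSquare Z) :
    InSquare (fun i => (Z i).swap) :=
  fun i => ⟨(h i).2.2.1, (h i).2.2.2, (h i).1, (h i).2.1⟩

theorem InSquare.reflect {ι : Type*} {Z : ι → Pt} (h : InSquare Z) :
    InSquare (fun i => reflect (Z i)) := by
  intro i
  obtain ⟨h1, h2, h3, h4⟩ := h i
  simp only [_root_.reflect]
  refine ⟨?_, ?_, ?_, ?_⟩ <;> linarith

/-- The line of level `u` of `α x + y` is reached by following one of the two chains, all points
of the chain up to this line being occupied. -/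
def ChainLevel {ι : Type*} (α β : ℝ) (Z : ι → Pt) (u : ℝ) : Prop :=
  u = 0 ∨ (∃ k, u = α * (α * β) ^ k ∧ ∀ n ≤ 2 * k, chainPt α β n ∈ Set.range Z) ∨
    ∃ k, u = (α * β) ^ (k + 1) ∧ ∀ n ≤ 2 * k + 1, (chainPt β α n).swap ∈ Set.range Z

/-- The line of level `u` of `α x + y` is reached by a chain or by a reflected chain. -/
def Reached {ι : Type*} (α β : ℝ) (Z : ι → Pt) (u : ℝ) : Prop :=
  ChainLevel α β Z u ∨ ChainLevel α β (fun i => reflect (Z i)) (1 + α - u)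

theorem reached_reflect {ι : Type*} {α β : ℝ} {Z : ι → Pt} {z : Pt} :
    Reached α β (fun i => reflect (Z i)) (level α (reflect z)) ↔ Reached α β Z (level α z) := by
  simp only [Reached, reflect_reflect, level_reflect, sub_sub_cancel]
  exact or_comm

theorem mem_range_swap {ι : Type*} {Z : ι → Pt} {p : Pt} :
    p ∈ Set.range (fun i => (Z i).swap) ↔ p.swap ∈ Set.range Z := by
  simp only [Set.mem_range]
  exact exists_congr fun i => ⟨fun h => by rw [← h, Prod.swap_swap],
    fun h => by rw [h, Prod.swap_swap]⟩

section

variable {ι : Type*} {α β : ℝ} {Z : ι → Pt}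

theorem ChainLevel.le {u : ℝ} (h : ChainLevel α β Z u) (hα0 : 0 < α) (hα1 : α < 1) (hβ0 : 0 < β)
    (hβ1 : β < 1) : u ≤ α := by
  have ht0 : 0 < α * β := by positivity
  have ht1 : α * β < 1 := by nlinarith
  rcases h with rfl | ⟨k, rfl, -⟩ | ⟨k, rfl, -⟩
  · exact hα0.le
  · have := pow_le_one₀ (n := k) ht0.le ht1.le
    nlinarith
  · have := pow_le_one₀ (n := k) ht0.le ht1.le
    rw [pow_succ]
    nlinarith

theorem ChainLevel.swap_of_side {i : ι} (h : ChainLevel α β Z (level α (Z i)))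
    (hα0 : 0 < α)
    (hi : (Z i).1 = 0 ∧ 0 < (Z i).2 ∨ (Z i).2 = 0 ∧ 0 < (Z i).1 ∧ (Z i).1 < 1) :
    ChainLevel β α (fun i => (Z i).swap) (level β (Z i).swap) := by
  simp only [ChainLevel, mem_range_swap, Prod.swap_swap, mul_comm β α, Nat.le_succ_iff,
    or_imp, forall_and, forall_eq] at h ⊢
  rcases hi with ⟨h0, hY⟩ | ⟨h0, hX, hX1⟩
  · have hl : level α (Z i) = (Z i).2 := by simp [level, h0]
    have hl' : level β (Z i).swap = β * (Z i).2 := by simp [level, h0]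
    rw [hl] at h
    rw [hl']
    rcases h with h | ⟨k, hk, hocc⟩ | ⟨k, hk, hocc⟩
    · exact absurd h hY.ne'
    · refine Or.inr (Or.inr ⟨k, ?_, hocc, ?_⟩)
      · rw [hk]; ring
      · exact ⟨i, by rw [chainPt_odd, ← hk, ← h0]⟩
    · refine Or.inr (Or.inl ⟨k + 1, ?_, ?_⟩)
      · rw [hk]
      · intro n hn
        obtain hn | rfl | rfl : n ≤ 2 * k ∨ n = 2 * k + 1 ∨ n = 2 * (k + 1) := by omega
        · exact hocc.1 n hn
        · exact hocc.2
        · exact ⟨i, by rw [chainPt_even, mul_comm β α, ← hk, ← h0]; rfl⟩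
  · have hl : level α (Z i) = α * (Z i).1 := by simp [level, h0]
    have hl' : level β (Z i).swap = (Z i).1 := by simp [level, h0]
    rw [hl] at h
    rw [hl']
    rcases h with h | ⟨k, hk, hocc⟩ | ⟨k, hk, hocc⟩
    · exact absurd h (by positivity)
    · have hk' := mul_left_cancel₀ hα0.ne' hk
      rcases k with _ | k
      · rw [pow_zero] at hk'
        exact absurd hk' hX1.ne
      · exact Or.inr (Or.inr ⟨k, hk', fun n hn => hocc n (by omega), hocc _ (by omega)⟩)
    · refine Or.inr (Or.inl ⟨k, ?_, hocc.1⟩)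
      apply mul_left_cancel₀ hα0.ne'
      rw [hk]; ring

theorem Reached.swap_of_low_side {i : ι} (h : Reached α β Z (level α (Z i)))
    (hα0 : 0 < α) (hα1 : α < 1) (hβ0 : 0 < β) (hβ1 : β < 1)
    (hi : (Z i).1 = 0 ∧ 0 < (Z i).2 ∧ (Z i).2 < 1 ∨ (Z i).2 = 0 ∧ 0 < (Z i).1 ∧ (Z i).1 < 1) :
    Reached β α (fun i => (Z i).swap) (level β (Z i).swap) := by
  rcases h with h | h
  · exact Or.inl (h.swap_of_side hα0 (by tauto))
  · have hle := h.le hα0 hα1 hβ0 hβ1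
    simp only [level] at hle
    rcases hi with ⟨h0, hY, hY1⟩ | ⟨h0, hX, hX1⟩ <;> rw [h0] at hle <;> nlinarith

theorem Reached.swap_of_side (hsq : InSquare Z) {i : ι} (h : Reached α β Z (level α (Z i)))
    (hα0 : 0 < α) (hα1 : α < 1) (hβ0 : 0 < β) (hβ1 : β < 1)
    (hi : (Z i).1 = 0 ∨ (Z i).1 = 1 ∨ (Z i).2 = 0 ∨ (Z i).2 = 1)
    (hc : ¬ (((Z i).1 = 0 ∨ (Z i).1 = 1) ∧ ((Z i).2 = 0 ∨ (Z i).2 = 1))) :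
    Reached β α (fun i => (Z i).swap) (level β (Z i).swap) := by
  obtain ⟨hx0, hx1, hy0, hy1⟩ := hsq i
  have hx : (Z i).1 = 0 ∨ (Z i).1 = 1 ∨ 0 < (Z i).1 ∧ (Z i).1 < 1 := by
    rcases hx0.eq_or_lt with h | h <;> rcases hx1.eq_or_lt with h' | h' <;> tauto
  have hy : (Z i).2 = 0 ∨ (Z i).2 = 1 ∨ 0 < (Z i).2 ∧ (Z i).2 < 1 := by
    rcases hy0.eq_or_lt with h | h <;> rcases hy1.eq_or_lt with h' | h' <;> tauto
  by_cases hlow : (Z i).1 = 0 ∨ (Z i).2 = 0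
  · exact h.swap_of_low_side hα0 hα1 hβ0 hβ1 (by tauto)
  · refine (reached_reflect (Z := fun i => (Z i).swap) (z := (Z i).swap)).1
      ((reached_reflect.2 h).swap_of_low_side (Z := fun i => reflect (Z i)) (i := i)
        hα0 hα1 hβ0 hβ1 ?_)
    simp only [reflect, sub_eq_zero, sub_pos, sub_lt_self_iff, eq_comm (a := (1 : ℝ))]
    tauto

theorem reached_of_corner {i : ι} (hi : (Z i).1 = 0 ∨ (Z i).1 = 1)
    (hi' : (Z i).2 = 0 ∨ (Z i).2 = 1) : Reached α β Z (level α (Z i)) := by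
  have h10 : chainPt α β 0 = (1, 0) := by simp [chainPt]
  rcases hi with h | h <;> rcases hi' with h' | h' <;> simp only [level, h, h']
  · exact Or.inl (Or.inl (by simp))
  · refine Or.inr (Or.inr (Or.inl ⟨0, by simp, ?_⟩))
    intro n hn
    obtain rfl : n = 0 := by omega
    rw [h10]
    exact ⟨i, by simp [reflect, h, h']⟩
  · refine Or.inl (Or.inr (Or.inl ⟨0, by simp, ?_⟩))
    intro n hn
    obtain rfl : n = 0 := by omega
    rw [h10]
    exact ⟨i, by rw [← h, ← h']⟩
  · exact Or.inr (Or.inl (by ring))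

theorem Rigid.reached (hZ : Rigid α β Z) (hsq : InSquare Z)
    (hα0 : 0 < α) (hα1 : α < 1) (hβ0 : 0 < β) (hβ1 : β < 1) (i : ι) :
    Reached α β Z (level α (Z i)) ∧ Reached β α (fun i => (Z i).swap) (level β (Z i).swap) := by
  refine hZ.mem_of_closed hsq hα0 hα1 hβ0 hβ1 (Reached α β Z)
    (Reached β α (fun i => (Z i).swap)) ?_ ?_ i
  · intro i hi hi'
    exact ⟨reached_of_corner hi hi', reached_of_corner (Z := fun i => (Z i).swap) hi' hi⟩
  · intro i hi
    by_cases hc : ((Z i).1 = 0 ∨ (Z i).1 = 1) ∧ ((Z i).2 = 0 ∨ (Z i).2 = 1)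
    · exact iff_of_true (reached_of_corner hc.1 hc.2)
        (reached_of_corner (Z := fun i => (Z i).swap) hc.2 hc.1)
    · refine ⟨fun h => h.swap_of_side hsq hα0 hα1 hβ0 hβ1 hi hc, fun h => ?_⟩
      exact Reached.swap_of_side (i := i) hsq.swap h hβ0 hβ1 hα0 hα1
        (by simp only [Prod.fst_swap, Prod.snd_swap]; tauto)
        (by simp only [Prod.fst_swap, Prod.snd_swap]; tauto)

end

theorem chainPt_pos {α β : ℝ} (hα0 : 0 < α) (hβ0 : 0 < β) (n : ℕ) :
    0 < (chainPt α β n).1 ∧ (chainPt α β n).2 = 0 ∨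
      (chainPt α β n).1 = 0 ∧ 0 < (chainPt α β n).2 := by
  obtain ⟨k, rfl | rfl⟩ := n.even_or_odd'
  · rw [chainPt_even]
    exact Or.inl ⟨by positivity, rfl⟩
  · rw [chainPt_odd]
    exact Or.inr ⟨rfl, by positivity⟩

theorem chainPt_injective {α β : ℝ} (hα0 : 0 < α) (hα1 : α < 1) (hβ0 : 0 < β) (hβ1 : β < 1) :
    Function.Injective (chainPt α β) := by
  have h : StrictAnti fun n => (chainPt α β n).1 + (chainPt α β n).2 := by
    refine strictAnti_nat_of_succ_lt fun n => ?_
    have hp : ∀ k, 0 < (α * β) ^ k := fun k => by positivity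
    obtain ⟨k, rfl | rfl⟩ := n.even_or_odd'
    · rw [chainPt_odd, chainPt_even]
      nlinarith [hp k]
    · rw [show 2 * k + 1 + 1 = 2 * (k + 1) by ring, chainPt_odd, chainPt_even, pow_succ]
      nlinarith [mul_pos hα0 (hp k)]
  intro m n hmn
  exact h.injective (by simp only [hmn])

theorem mul_pow_ne_pow {s t : ℝ} (ht0 : 0 < t) (hts : t < s) (hs1 : s < 1) (j k : ℕ) :
    s * t ^ j ≠ t ^ k := by
  intro h
  rcases Nat.lt_or_ge j k with hjk | hjk
  · have h1 := pow_le_pow_of_le_one ht0.le (hts.trans hs1).le (Nat.succ_le_of_lt hjk)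
    rw [pow_succ] at h1
    nlinarith [pow_pos ht0 j]
  · have h1 := pow_le_pow_of_le_one ht0.le (hts.trans hs1).le hjk
    nlinarith [pow_pos ht0 j]

theorem chainPt_ne_swap {α β : ℝ} (hα0 : 0 < α) (hα1 : α < 1) (hβ0 : 0 < β) (hβ1 : β < 1)
    (m n : ℕ) : chainPt α β m ≠ (chainPt β α n).swap := by
  have ht0 : 0 < α * β := by positivity
  have hp : ∀ k, 0 < (α * β) ^ k := fun k => by positivity
  intro h
  obtain ⟨k, rfl | rfl⟩ := m.even_or_odd' <;> obtain ⟨j, rfl | rfl⟩ := n.even_or_odd' <;>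
    simp only [chainPt_even, chainPt_odd, Prod.swap_prod_mk, Prod.mk.injEq, mul_comm β α] at h
  · exact (hp k).ne' h.1
  · exact mul_pow_ne_pow ht0 (by nlinarith) hβ1 _ _ h.1.symm
  · exact mul_pow_ne_pow ht0 (by nlinarith) hα1 _ _ h.2
  · exact (mul_pos hα0 (hp k)).ne' h.2

theorem crossPt_pos {α β : ℝ} (hα0 : 0 < α) (hα1 : α < 1) (hβ0 : 0 < β) (hβ1 : β < 1) (n : ℕ) :
    0 < (crossPt α β n).1 ∧ 0 < (crossPt α β n).2 := by
  have h1 : 0 < 1 - α := by linarith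
  have h2 : 0 < 1 - β := by linarith
  have h3 : 0 < 1 - α * β := by nlinarith
  obtain ⟨k, rfl | rfl⟩ := n.even_or_odd'
  · rw [crossPt_even]
    constructor <;> positivity
  · rw [crossPt_odd]
    constructor <;> positivity

theorem Finset.card_le_of_subset_range {q : ℕ} {X : Type*} {Z : Fin q → X} (s : Finset X)
    (h : ∀ x ∈ s, x ∈ Set.range Z) : s.card ≤ q := by
  classical
  calc s.card ≤ (Finset.univ.image Z).card :=
        Finset.card_le_card fun x hx => by simpa using h x hx
    _ ≤ q := by simpa using Finset.card_image_le (s := (Finset.univ : Finset (Fin q))) (f := Z)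

section

variable {q : ℕ} {α β : ℝ} {Z : Fin q → Pt}

theorem lt_of_chainPt_mem_range (hα0 : 0 < α) (hα1 : α < 1) (hβ0 : 0 < β) (hβ1 : β < 1) {N : ℕ}
    (h : ∀ n ≤ N, chainPt α β n ∈ Set.range Z) : N < q := by
  have hinj := chainPt_injective hα0 hα1 hβ0 hβ1
  have := Finset.card_le_of_subset_range (Z := Z)
    ((Finset.range (N + 1)).map ⟨_, hinj⟩) (by simpa [Nat.lt_succ_iff] using h)
  simpa [Nat.succ_le_iff] using this

theorem le_of_crossPt_mem_range (hα0 : 0 < α) (hα1 : α < 1) (hβ0 : 0 < β) (hβ1 : β < 1) {N : ℕ}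
    (h : ∀ n ≤ N, chainPt α β n ∈ Set.range Z)
    (h' : ∀ n ≤ N, (chainPt β α n).swap ∈ Set.range Z)
    (hc : crossPt α β N ∈ Set.range Z) : 2 * N + 3 ≤ q := by
  classical
  let s := (Finset.range (N + 1)).map ⟨_, chainPt_injective hα0 hα1 hβ0 hβ1⟩
  let s' := (Finset.range (N + 1)).map
    ⟨_, Prod.swap_injective.comp (chainPt_injective hβ0 hβ1 hα0 hα1)⟩
  have hdisj : Disjoint s s' := by
    rw [Finset.disjoint_left]
    intro p hp hp'
    simp only [s, s', Finset.mem_map, Function.Embedding.coeFn_mk, Function.comp] at hp hp'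
    obtain ⟨m, -, rfl⟩ := hp
    obtain ⟨n, -, hn⟩ := hp'
    exact chainPt_ne_swap hα0 hα1 hβ0 hβ1 m n hn.symm
  have hpos := crossPt_pos hα0 hα1 hβ0 hβ1 N
  have hnot : crossPt α β N ∉ s.disjUnion s' hdisj := by
    simp only [s, s', Finset.mem_disjUnion, Finset.mem_map, Function.Embedding.coeFn_mk,
      Function.comp]
    rintro (⟨m, -, hm⟩ | ⟨m, -, hm⟩)
    · have := chainPt_pos hα0 hβ0 m
      rw [hm] at this
      rcases this with h | h <;> linarith
    · have := chainPt_pos hβ0 hα0 m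
      rw [← Prod.swap_swap (chainPt β α m), hm, Prod.fst_swap, Prod.snd_swap] at this
      rcases this with h | h <;> linarith
  have hcard := Finset.card_le_of_subset_range (Z := Z)
    (Finset.cons _ (s.disjUnion s' hdisj) hnot) ?_
  · simp only [Finset.card_cons, Finset.card_disjUnion, s, s', Finset.card_map,
      Finset.card_range] at hcard
    omega
  · intro x hx
    simp only [Finset.mem_cons, Finset.mem_disjUnion, s, s', Finset.mem_map,
      Function.Embedding.coeFn_mk, Function.comp, Finset.mem_range, Nat.lt_succ_iff] at hx
    rcases hx with rfl | ⟨m, hm, rfl⟩ | ⟨m, hm, rfl⟩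
    · exact hc
    · exact h m hm
    · exact h' m hm

end

/-- The points which can be occupied in a rigid configuration of `q` points, up to reflection. -/
def IsTrajPt (α β : ℝ) (q : ℕ) (p : Pt) : Prop :=
  p = 0 ∨ (∃ n < q, p = chainPt α β n) ∨ (∃ n < q, p = (chainPt β α n).swap) ∨
    ∃ n, 2 * n + 3 ≤ q ∧ p = crossPt α β n

theorem IsTrajPt.swap {α β : ℝ} {q : ℕ} {p : Pt} (h : IsTrajPt α β q p) :
    IsTrajPt β α q p.swap := by
  rcases h with rfl | ⟨n, hn, rfl⟩ | ⟨n, hn, rfl⟩ | ⟨n, hn, rfl⟩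
  · exact Or.inl rfl
  · exact Or.inr (Or.inr (Or.inl ⟨n, hn, rfl⟩))
  · exact Or.inr (Or.inl ⟨n, hn, Prod.swap_swap _⟩)
  · exact Or.inr (Or.inr (Or.inr ⟨n, hn, crossPt_swap _ _ _⟩))

theorem eq_of_level {α β : ℝ} (ht : 1 - α * β ≠ 0) {p p' : Pt} (h : level α p = level α p')
    (h' : level β p.swap = level β p'.swap) : p = p' := by
  simp only [level, Prod.fst_swap, Prod.snd_swap] at h h'
  refine Prod.ext ?_ ?_
  · exact mul_left_cancel₀ ht (by linear_combination h' - β * h)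
  · exact mul_left_cancel₀ ht (by linear_combination h - α * h')

theorem eq_of_mul_pow_le {s s' t : ℝ} (ht0 : 0 < t) (ht1 : t < 1) (hs : t < s) (hs' : t < s')
    {j k : ℕ} (h : s * t ^ k ≤ t ^ j) (h' : s' * t ^ j ≤ t ^ k) : j = k := by
  rcases lt_trichotomy j k with hjk | hjk | hjk
  · have h1 := pow_le_pow_of_le_one ht0.le ht1.le (Nat.succ_le_of_lt hjk)
    rw [pow_succ] at h1
    nlinarith [pow_pos ht0 j]
  · exact hjk
  · have h1 := pow_le_pow_of_le_one ht0.le ht1.le (Nat.succ_le_of_lt hjk)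
    rw [pow_succ] at h1
    nlinarith [pow_pos ht0 k]

section

variable {q : ℕ} {α β : ℝ} {Z : Fin q → Pt}

/-- A crossing of a line through `(t ^ k, 0)` with a line through `(t ^ (j + 1), 0)`, both on the
chain starting at `(1, 0)`, lies on this chain. -/
theorem isTrajPt_of_same_chain (hα0 : 0 < α) (hα1 : α < 1) (hβ0 : 0 < β) (hβ1 : β < 1)
    {i : Fin q} (hX : 0 ≤ (Z i).1) (hY : 0 ≤ (Z i).2) {k j : ℕ}
    (hk : level α (Z i) = α * (α * β) ^ k) (hocc : ∀ n ≤ 2 * k, chainPt α β n ∈ Set.range Z)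
    (hj : level β (Z i).swap = (α * β) ^ (j + 1))
    (hocc' : ∀ n ≤ 2 * j + 1, chainPt α β n ∈ Set.range Z) : IsTrajPt α β q (Z i) := by
  have ht0 : 0 < α * β := by positivity
  have ht1 : α * β < 1 := by nlinarith
  have h1 : (α * β) ^ (k + 1) ≤ (α * β) ^ (j + 1) := by
    rw [← hj, pow_succ]
    have : β * level α (Z i) = (α * β) ^ k * (α * β) := by rw [hk]; ring
    rw [← this]
    simp only [level, Prod.fst_swap, Prod.snd_swap]
    nlinarith
  have h2 : (α * β) ^ (j + 1) ≤ (α * β) ^ k := by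
    refine le_of_mul_le_mul_left ?_ hα0
    rw [← hk, ← hj]
    simp only [level, Prod.fst_swap, Prod.snd_swap]
    nlinarith
  rw [pow_le_pow_iff_right_of_lt_one₀ ht0 ht1] at h1 h2
  obtain rfl | rfl : k = j ∨ k = j + 1 := by omega
  · have hp : Z i = chainPt α β (2 * k + 1) := by
      refine eq_of_level (α := α) (β := β) (by linarith) ?_ ?_
      · rw [hk, chainPt_odd]; simp [level]
      · rw [hj, chainPt_odd]; simp [level]; ring
    exact Or.inr (Or.inl ⟨_, lt_of_chainPt_mem_range hα0 hα1 hβ0 hβ1 hocc', hp⟩)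
  · have hp : Z i = chainPt α β (2 * (j + 1)) := by
      refine eq_of_level (α := α) (β := β) (by linarith) ?_ ?_
      · rw [hk, chainPt_even]; simp [level]
      · rw [hj, chainPt_even]; simp [level]
    exact Or.inr (Or.inl ⟨_, lt_of_chainPt_mem_range hα0 hα1 hβ0 hβ1 hocc, hp⟩)

theorem isTrajPt_of_chainLevel (hα0 : 0 < α) (hα1 : α < 1) (hβ0 : 0 < β) (hβ1 : β < 1)
    {i : Fin q} (hX : 0 ≤ (Z i).1) (hY : 0 ≤ (Z i).2)
    (hu : ChainLevel α β Z (level α (Z i)))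
    (hv : ChainLevel β α (fun i => (Z i).swap) (level β (Z i).swap)) :
    IsTrajPt α β q (Z i) := by
  have ht0 : 0 < α * β := by positivity
  have ht1 : α * β < 1 := by nlinarith
  have ht : 1 - α * β ≠ 0 := by linarith
  have hle : β * level α (Z i) ≤ level β (Z i).swap := by
    simp only [level, Prod.fst_swap, Prod.snd_swap]; nlinarith
  have hle' : α * level β (Z i).swap ≤ level α (Z i) := by
    simp only [level, Prod.fst_swap, Prod.snd_swap]; nlinarith
  have hpos : 0 ≤ level α (Z i) ∧ 0 ≤ level β (Z i).swap := by
    simp only [level, Prod.fst_swap, Prod.snd_swap]; constructor <;> positivity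
  simp only [ChainLevel, mem_range_swap, Prod.swap_swap, mul_comm β α] at hu hv
  have hzero : level α (Z i) = 0 → level β (Z i).swap = 0 → IsTrajPt α β q (Z i) :=
    fun h h' => Or.inl (eq_of_level ht (by rw [h]; simp [level]) (by rw [h']; simp [level]))
  rcases hu with hu | ⟨k, hk, hocc⟩ | ⟨k, hk, hocc⟩
  · exact hzero hu (by nlinarith)
  · rcases hv with hv | ⟨j, hj, hocc'⟩ | ⟨j, hj, hocc'⟩
    · exact hzero (by nlinarith) hv
    · rw [hk, hj] at hle hle'
      obtain rfl : j = k := by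
        refine eq_of_mul_pow_le ht0 ht1 (s := α) (s' := β) (by nlinarith) (by nlinarith) ?_ ?_
        · refine le_of_mul_le_mul_left hle hβ0
        · refine le_of_mul_le_mul_left hle' hα0
      have hp : Z i = crossPt α β (2 * j) := by
        refine eq_of_level ht ?_ ?_
        · rw [hk, crossPt_even]; simp only [level]; field_simp; ring
        · rw [hj, crossPt_even]
          simp only [level, Prod.swap_prod_mk]
          linear_combination (-β * (α * β) ^ j) * mul_inv_cancel₀ ht
      exact Or.inr (Or.inr (Or.inr ⟨_,
        le_of_crossPt_mem_range hα0 hα1 hβ0 hβ1 hocc hocc' ⟨i, hp⟩, hp⟩))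
    · exact isTrajPt_of_same_chain hα0 hα1 hβ0 hβ1 hX hY hk hocc hj hocc'
  · rcases hv with hv | ⟨j, hj, hocc'⟩ | ⟨j, hj, hocc'⟩
    · exact hzero (by nlinarith) hv
    · refine (isTrajPt_of_same_chain (Z := fun i => (Z i).swap) (i := i) hβ0 hβ1 hα0 hα1 hY hX
        (k := j) (j := k) ?_ ?_ ?_ ?_).swap
      · rw [hj, mul_comm α β]
      · simpa only [mem_range_swap] using hocc'
      · rw [Prod.swap_swap, hk, mul_comm α β]
      · simpa only [mem_range_swap] using hocc
    · rw [hk, hj] at hle hle'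
      have := eq_of_mul_pow_le ht0 ht1 (s := β) (s' := α) (by nlinarith) (by nlinarith) hle hle'
      obtain rfl : j = k := by omega
      have hp : Z i = crossPt α β (2 * j + 1) := by
        refine eq_of_level ht ?_ ?_
        · rw [hk, crossPt_odd]; simp only [level]; field_simp; ring
        · rw [hj, crossPt_odd]; simp only [level, Prod.swap_prod_mk]; field_simp; ring
      exact Or.inr (Or.inr (Or.inr ⟨_,
        le_of_crossPt_mem_range hα0 hα1 hβ0 hβ1 hocc' hocc ⟨i, hp⟩, hp⟩))

/-- A line of a reflected chain and a line of the other family of an unreflected chain can meet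
in the square only at `(1, 0)`. -/
theorem isTrajPt_of_chainLevel_reflect (hα0 : 0 < α) (hα1 : α < 1) (hβ0 : 0 < β) (hβ1 : β < 1)
    {i : Fin q} (hX : (Z i).1 ≤ 1) (hY : 0 ≤ (Z i).2)
    (hu : ChainLevel α β Z (level α (Z i)))
    (hv : ChainLevel β α (fun i => (reflect (Z i)).swap) (1 + β - level β (Z i).swap)) :
    IsTrajPt α β q (Z i) := by
  have h1 := hu.le hα0 hα1 hβ0 hβ1
  have h2 := hv.le hβ0 hβ1 hα0 hα1
  simp only [level, Prod.fst_swap, Prod.snd_swap] at h1 h2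
  have ht1 : α * β < 1 := by nlinarith
  have hY0 : (Z i).2 = 0 := by nlinarith
  have hX1 : (Z i).1 = 1 := by rw [hY0] at h2; linarith
  refine Or.inr (Or.inl ⟨0, Fin.pos i, Prod.ext ?_ ?_⟩)
  · simp [chainPt, hX1]
  · simp [chainPt, hY0]

/-- Every point of a rigid configuration in the square is, up to reflection, a point of a chain or
a crossing point. -/
theorem Rigid.isTrajPt (hZ : Rigid α β Z) (hsq : InSquare Z)
    (hα0 : 0 < α) (hα1 : α < 1) (hβ0 : 0 < β) (hβ1 : β < 1) (i : Fin q) :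
    IsTrajPt α β q (Z i) ∨ IsTrajPt α β q (reflect (Z i)) := by
  obtain ⟨h1, h2⟩ := hZ.reached hsq hα0 hα1 hβ0 hβ1 i
  obtain ⟨hX0, hX1, hY0, hY1⟩ := hsq i
  rcases h1 with h1 | h1 <;> rcases h2 with h2 | h2
  · exact Or.inl (isTrajPt_of_chainLevel hα0 hα1 hβ0 hβ1 hX0 hY0 h1 h2)
  · exact Or.inl (isTrajPt_of_chainLevel_reflect hα0 hα1 hβ0 hβ1 hX1 hY0 h1 h2)
  · exact Or.inl (isTrajPt_of_chainLevel_reflect (Z := fun i => (Z i).swap) (i := i)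
      hβ0 hβ1 hα0 hα1 hY1 hX0 h2 h1).swap
  · rw [← level_reflect] at h1 h2
    exact Or.inr (isTrajPt_of_chainLevel (Z := fun i => reflect (Z i)) (i := i) hα0 hα1 hβ0 hβ1
      (by simpa [reflect] using hX1) (by simpa [reflect] using hY1) h1 h2)

end

section

variable {ι : Type*} {α β : ℝ} {Z W : ι → Pt}

theorem Compat.eq_chainPt (h : Compat α β Z W) {N : ℕ}
    (hocc : ∀ n ≤ N, chainPt α β n ∈ Set.range Z) {n : ℕ} (hn : n ≤ N) {i : ι}
    (hi : Z i = chainPt α β n) : W i = Z i := by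
  induction n generalizing i with
  | zero =>
    have hi' : Z i = (1, 0) := by simpa [chainPt] using hi
    rw [hi']
    exact Prod.ext (h.right i (by rw [hi'])) (h.bot i (by rw [hi']))
  | succ n ih =>
    obtain ⟨j, hj⟩ := hocc n (by omega)
    have hWj := ih (by omega) hj
    obtain ⟨k, rfl | rfl⟩ := n.even_or_odd'
    · rw [chainPt_even] at hj
      rw [chainPt_odd] at hi
      have h1 : (W i).1 = 0 := h.left i (by rw [hi])
      have h2 := h.fst i j (by rw [hi, hj]; simp [level])
      rw [hWj, hj] at h2
      simp only [level, h1] at h2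
      rw [hi]
      exact Prod.ext h1 (by linarith)
    · rw [chainPt_odd] at hj
      rw [show 2 * k + 1 + 1 = 2 * (k + 1) by ring, chainPt_even] at hi
      have h1 : (W i).2 = 0 := h.bot i (by rw [hi])
      have h2 := h.snd i j (by rw [hi, hj]; simp only [level, Prod.swap_prod_mk]; ring)
      rw [hWj, hj] at h2
      simp only [level, Prod.fst_swap, Prod.snd_swap, h1] at h2
      rw [hi]
      exact Prod.ext (by rw [pow_succ]; linarith) h1

theorem Compat.eq_chainPt_swap (h : Compat α β Z W) {N : ℕ}
    (hocc : ∀ n ≤ N, (chainPt β α n).swap ∈ Set.range Z) {n : ℕ} (hn : n ≤ N) {i : ι}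
    (hi : Z i = (chainPt β α n).swap) : W i = Z i := by
  have := h.swap.eq_chainPt (N := N) (by simpa only [mem_range_swap] using hocc) hn (i := i)
    (by rw [hi, Prod.swap_swap])
  exact Prod.swap_injective this

end

theorem chainPt_mem_square {α β : ℝ} (hα0 : 0 < α) (hα1 : α < 1) (hβ0 : 0 < β) (hβ1 : β < 1)
    (n : ℕ) : 0 ≤ (chainPt α β n).1 ∧ (chainPt α β n).1 ≤ 1 ∧ 0 ≤ (chainPt α β n).2 ∧
      (chainPt α β n).2 ≤ 1 := by
  have ht1 : α * β ≤ 1 := by nlinarith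
  have ht0 : 0 < α * β := by positivity
  obtain ⟨k, rfl | rfl⟩ := n.even_or_odd'
  · rw [chainPt_even]
    exact ⟨by positivity, pow_le_one₀ ht0.le ht1, le_rfl, zero_le_one⟩
  · rw [chainPt_odd]
    exact ⟨le_rfl, zero_le_one, by positivity, mul_le_one₀ hα1.le (by positivity)
      (pow_le_one₀ ht0.le ht1)⟩

theorem crossPt_mem_square {α β : ℝ} (hα0 : 0 < α) (hα1 : α < 1) (hβ0 : 0 < β) (hβ1 : β < 1)
    (n : ℕ) : 0 ≤ (crossPt α β n).1 ∧ (crossPt α β n).1 ≤ 1 ∧ 0 ≤ (crossPt α β n).2 ∧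
      (crossPt α β n).2 ≤ 1 := by
  have ht1 : α * β < 1 := by nlinarith
  have ht0 : 0 < α * β := by positivity
  have h3 : 0 < 1 - α * β := by linarith
  obtain ⟨h1, h2⟩ := crossPt_pos hα0 hα1 hβ0 hβ1 n
  have hpow : ∀ k, (α * β) ^ k ≤ 1 := fun k => pow_le_one₀ ht0.le ht1.le
  have hpow' : ∀ k, (α * β) ^ (k + 1) ≤ α * β := fun k => pow_le_of_le_one ht0.le ht1.le (by omega)
  have aux : ∀ s c : ℝ, s ≤ 1 → 0 ≤ c → c ≤ 1 - α * β → s * c / (1 - α * β) ≤ 1 := by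
    intro s c hs hc hc'
    rw [div_le_one h3]
    nlinarith
  refine ⟨h1.le, ?_, h2.le, ?_⟩ <;> obtain ⟨k, rfl | rfl⟩ := n.even_or_odd' <;>
    simp only [crossPt_even, crossPt_odd] <;> refine aux _ _ (hpow _) ?_ ?_ <;> nlinarith

section

variable {q : ℕ} {α β : ℝ}

theorem exists_rigid_chainPt (hα0 : 0 < α) (hα1 : α < 1) (hβ0 : 0 < β) (hβ1 : β < 1)
    {n : ℕ} (hn : n < q) :
    ∃ Z : Fin q → Pt, InSquare Z ∧ Rigid α β Z ∧ ∃ i, Z i = chainPt α β n := by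
  refine ⟨fun i => chainPt α β (min i n), fun i => chainPt_mem_square hα0 hα1 hβ0 hβ1 _,
    fun W hW => ?_, ⟨⟨n, hn⟩, by simp⟩⟩
  funext i
  refine hW.eq_chainPt (N := n) (fun m hm => ⟨⟨m, by omega⟩, ?_⟩) (min_le_right _ _) rfl
  simp [hm]

theorem exists_rigid_chainPt_swap (hα0 : 0 < α) (hα1 : α < 1) (hβ0 : 0 < β) (hβ1 : β < 1)
    {n : ℕ} (hn : n < q) :
    ∃ Z : Fin q → Pt, InSquare Z ∧ Rigid α β Z ∧ ∃ i, Z i = (chainPt β α n).swap := by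
  obtain ⟨Z, h1, h2, i, h3⟩ := exists_rigid_chainPt hβ0 hβ1 hα0 hα1 hn
  exact ⟨fun i => (Z i).swap, h1.swap, h2.swap, i, by simp only [h3]⟩

theorem level_crossPt (ht : 1 - α * β ≠ 0) (n : ℕ) :
    level α (crossPt α β n) = level α (chainPt α β n) ∧
      level β (crossPt α β n).swap = level β (chainPt β α n) ∨
    level α (crossPt α β n) = level α (chainPt β α n).swap ∧
      level β (crossPt α β n).swap = level β (chainPt α β n).swap := by
  obtain ⟨k, rfl | rfl⟩ := n.even_or_odd'
  · left
    simp only [crossPt_even, chainPt_even, level, Prod.swap_prod_mk, mul_comm β α]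
    constructor
    · linear_combination (α * (α * β) ^ k) * mul_inv_cancel₀ ht
    · linear_combination (β * (α * β) ^ k) * mul_inv_cancel₀ ht
  · right
    simp only [crossPt_odd, chainPt_odd, level, Prod.swap_prod_mk, mul_comm β α]
    constructor
    · linear_combination ((α * β) ^ (k + 1)) * mul_inv_cancel₀ ht
    · linear_combination ((α * β) ^ (k + 1)) * mul_inv_cancel₀ ht

theorem exists_rigid_crossPt (hα0 : 0 < α) (hα1 : α < 1) (hβ0 : 0 < β) (hβ1 : β < 1)
    {n : ℕ} (hn : 2 * n + 3 ≤ q) :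
    ∃ Z : Fin q → Pt, InSquare Z ∧ Rigid α β Z ∧ ∃ i, Z i = crossPt α β n := by
  let Z : Fin q → Pt := fun i => if i.1 ≤ n then chainPt α β i else
    if i.1 ≤ 2 * n + 1 then (chainPt β α (i - (n + 1))).swap else crossPt α β n
  have ht : 1 - α * β ≠ 0 := by nlinarith
  have hocc : ∀ m ≤ n, chainPt α β m ∈ Set.range Z :=
    fun m hm => ⟨⟨m, by omega⟩, by simp [Z, hm]⟩
  have hocc' : ∀ m ≤ n, (chainPt β α m).swap ∈ Set.range Z := by
    refine fun m hm => ⟨⟨m + (n + 1), by omega⟩, ?_⟩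
    have h1 : ¬ (m + (n + 1) ≤ n) := by omega
    have h2 : m + (n + 1) ≤ 2 * n + 1 := by omega
    simp only [Z, h1, h2, if_true, if_false, Nat.add_sub_cancel]
  refine ⟨Z, fun i => ?_, fun W hW => ?_, ⟨2 * n + 2, by omega⟩, ?_⟩
  · simp only [Z]
    split_ifs
    · exact chainPt_mem_square hα0 hα1 hβ0 hβ1 _
    · obtain ⟨h1, h2, h3, h4⟩ := chainPt_mem_square hβ0 hβ1 hα0 hα1 (i - (n + 1))
      exact ⟨h3, h4, h1, h2⟩
    · exact crossPt_mem_square hα0 hα1 hβ0 hβ1 _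
  · funext i
    by_cases h1 : i.1 ≤ n
    · exact hW.eq_chainPt hocc h1 (by simp [Z, h1])
    by_cases h2 : i.1 ≤ 2 * n + 1
    · exact hW.eq_chainPt_swap hocc' (n := i - (n + 1)) (by omega) (by simp [Z, h1, h2])
    have hi : Z i = crossPt α β n := by simp only [Z, h1, h2, if_false]
    obtain ⟨j, hj⟩ := hocc n le_rfl
    obtain ⟨l, hl⟩ := hocc' n le_rfl
    have hWj := hW.eq_chainPt hocc le_rfl hj
    have hWl := hW.eq_chainPt_swap hocc' le_rfl hl
    rcases level_crossPt ht n with ⟨e1, e2⟩ | ⟨e1, e2⟩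
    · have f1 : level α (Z i) = level α (Z j) := by rw [hi, hj, e1]
      have f2 : level β (Z i).swap = level β (Z l).swap := by rw [hi, hl, e2, Prod.swap_swap]
      refine eq_of_level ht ?_ ?_
      · rw [hW.fst i j f1, hWj, f1]
      · rw [hW.snd i l f2, hWl, f2]
    · have f1 : level α (Z i) = level α (Z l) := by rw [hi, hl, e1]
      have f2 : level β (Z i).swap = level β (Z j).swap := by rw [hi, hj, e2]
      refine eq_of_level ht ?_ ?_
      · rw [hW.fst i l f1, hWl, f1]
      · rw [hW.snd i j f2, hWj, f2]
  · have h1 : ¬ (2 * n + 2 ≤ n) := by omega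
    simp [Z, h1]

end

/-- The reflection of the unit square in the line `y = 1 / 2`. -/
def flipPt (z : Pt) : Pt := (z.1, 1 - z.2)

theorem flipPt_flipPt (z : Pt) : flipPt (flipPt z) = z := by
  simp [flipPt]

theorem confDot_unitVec {q : ℕ} (i : Fin q) (v : Pt) (w : Conf q) :
    confDot (unitVec i v) w = dotp v (w i) := by
  rw [confDot, Finset.sum_eq_single i]
  · simp [unitVec]
  · intro k _ hk
    simp [unitVec, hk, dotp]
  · simp

theorem confDot_attackNormal {q : ℕ} {i j : Fin q} (hij : i ≠ j) (v : Pt) (w : Conf q) :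
    confDot (attackNormal i j v) w = dotp (w i - w j) v := by
  have h : ∀ k, dotp (attackNormal i j v k) (w k) =
      dotp (unitVec i v k) (w k) - dotp (unitVec j v k) (w k) := by
    intro k
    by_cases h1 : k = i
    · subst h1
      simp [attackNormal, unitVec, hij, dotp]
    · by_cases h2 : k = j
      · subst h2
        simp only [attackNormal, unitVec, h1, dotp, if_true, if_false, Prod.fst_neg,
          Prod.snd_neg, Prod.fst_zero, Prod.snd_zero]
        ring
      · simp [attackNormal, unitVec, h1, h2, dotp]
  rw [confDot, Finset.sum_congr rfl fun k _ => h k, Finset.sum_sub_distrib]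
  change confDot _ w - confDot _ w = _
  rw [confDot_unitVec, confDot_unitVec]
  simp only [dotp, Prod.fst_sub, Prod.snd_sub]
  ring

namespace Board

variable {Bd : Board}

theorem mem_iff (hBd : Bd.set = unitSq) (z : Pt) :
    (∀ j, dotp (Bd.A j) z ≤ Bd.β j) ↔ 0 ≤ z.1 ∧ z.1 ≤ 1 ∧ 0 ≤ z.2 ∧ z.2 ≤ 1 := by
  have : z ∈ Bd.set ↔ z ∈ unitSq := by rw [hBd]
  refine this.trans ?_
  simp only [unitSq, Set.mem_Icc, Prod.le_def]
  tauto

/-- The defining lines of the unit square, apart from trivial ones, are its four sides. -/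
theorem side_cases (hBd : Bd.set = unitSq) (e : Fin Bd.s) :
    (Bd.A e = 0 ∧ Bd.β e = 0) ∨ ∃ ρ : ℝ, 0 < ρ ∧
    (Bd.A e = (-ρ, 0) ∧ Bd.β e = 0 ∨ Bd.A e = (ρ, 0) ∧ Bd.β e = ρ ∨
      Bd.A e = (0, -ρ) ∧ Bd.β e = 0 ∨ Bd.A e = (0, ρ) ∧ Bd.β e = ρ) := by
  obtain ⟨u, v, huv, hu, hv, hue, hve⟩ := Bd.edges e
  rw [mem_iff hBd] at hu hv
  obtain ⟨a, b, hA⟩ : ∃ a b : ℝ, Bd.A e = (a, b) := ⟨_, _, rfl⟩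
  have hle : ∀ x y : ℝ, 0 ≤ x → x ≤ 1 → 0 ≤ y → y ≤ 1 → a * x + b * y ≤ Bd.β e := by
    intro x y hx hx' hy hy'
    have := (mem_iff hBd (x, y)).2 ⟨hx, hx', hy, hy'⟩ e
    rwa [hA] at this
  have key : ∀ w : Pt, (0 ≤ w.1 ∧ w.1 ≤ 1 ∧ 0 ≤ w.2 ∧ w.2 ≤ 1) → dotp (Bd.A e) w = Bd.β e →
      (0 < a → w.1 = 1) ∧ (a < 0 → w.1 = 0) ∧ (0 < b → w.2 = 1) ∧ (b < 0 → w.2 = 0) := by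
    rintro ⟨x, y⟩ ⟨hx, hx', hy, hy'⟩ hw
    simp only [hA, dotp] at hw hx hx' hy hy' ⊢
    have h1 := hle 1 y zero_le_one le_rfl hy hy'
    have h2 := hle 0 y le_rfl zero_le_one hy hy'
    have h3 := hle x 1 hx hx' zero_le_one le_rfl
    have h4 := hle x 0 hx hx' le_rfl zero_le_one
    refine ⟨fun h => ?_, fun h => ?_, fun h => ?_, fun h => ?_⟩ <;> nlinarith
  obtain ⟨u1, u2, u3, u4⟩ := key u hu hue
  obtain ⟨v1, v2, v3, v4⟩ := key v hv hve
  have hab : a = 0 ∨ b = 0 := by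
    by_contra! h
    apply huv
    refine Prod.ext ?_ ?_
    · rcases lt_or_gt_of_ne h.1 with h | h
      · rw [u2 h, v2 h]
      · rw [u1 h, v1 h]
    · rcases lt_or_gt_of_ne h.2 with h | h
      · rw [u4 h, v4 h]
      · rw [u3 h, v3 h]
  simp only [hA, dotp] at hue ⊢
  rcases hab with rfl | rfl
  · rcases lt_trichotomy b 0 with h | rfl | h
    · refine Or.inr ⟨-b, by linarith, Or.inr (Or.inr (Or.inl ⟨by simp, ?_⟩))⟩
      rw [← hue, u4 h]; simp
    · exact Or.inl ⟨rfl, by rw [← hue]; simp⟩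
    · refine Or.inr ⟨b, h, Or.inr (Or.inr (Or.inr ⟨rfl, ?_⟩))⟩
      rw [← hue, u3 h]; simp
  · rcases lt_trichotomy a 0 with h | rfl | h
    · refine Or.inr ⟨-a, by linarith, Or.inl ⟨by simp, ?_⟩⟩
      rw [← hue, u2 h]; simp
    · exact Or.inl ⟨rfl, by rw [← hue]; simp⟩
    · refine Or.inr ⟨a, h, Or.inr (Or.inl ⟨rfl, ?_⟩)⟩
      rw [← hue, u1 h]; simp

/-- Every side of the unit square occurs among the defining lines. -/
theorem exists_side (hBd : Bd.set = unitSq) :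
    (∃ e, ∀ z, dotp (Bd.A e) z = Bd.β e ↔ z.1 = 0) ∧
    (∃ e, ∀ z, dotp (Bd.A e) z = Bd.β e ↔ z.1 = 1) ∧
    (∃ e, ∀ z, dotp (Bd.A e) z = Bd.β e ↔ z.2 = 0) ∧
    ∃ e, ∀ z, dotp (Bd.A e) z = Bd.β e ↔ z.2 = 1 := by
  refine ⟨?_, ?_, ?_, ?_⟩
  · by_contra! hne
    have := (mem_iff hBd (-1, 1 / 2)).1 fun e => ?_
    · norm_num at this
    obtain ⟨z, hz⟩ := hne e
    rcases side_cases hBd e with ⟨hA, hB⟩ | ⟨ρ, hρ, h⟩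
    · simp [hA, hB, dotp]
    have hρ' := hρ.ne'
    rcases h with ⟨hA, hB⟩ | ⟨hA, hB⟩ | ⟨hA, hB⟩ | ⟨hA, hB⟩ <;>
      simp [hA, hB, dotp, hρ'] at hz ⊢ <;> first | tauto | linarith
  · by_contra! hne
    have := (mem_iff hBd (2, 1 / 2)).1 fun e => ?_
    · norm_num at this
    obtain ⟨z, hz⟩ := hne e
    rcases side_cases hBd e with ⟨hA, hB⟩ | ⟨ρ, hρ, h⟩
    · simp [hA, hB, dotp]
    have hρ' := hρ.ne'
    rcases h with ⟨hA, hB⟩ | ⟨hA, hB⟩ | ⟨hA, hB⟩ | ⟨hA, hB⟩ <;>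
      simp [hA, hB, dotp, hρ'] at hz ⊢ <;> first | tauto | linarith
  · by_contra! hne
    have := (mem_iff hBd (1 / 2, -1)).1 fun e => ?_
    · norm_num at this
    obtain ⟨z, hz⟩ := hne e
    rcases side_cases hBd e with ⟨hA, hB⟩ | ⟨ρ, hρ, h⟩
    · simp [hA, hB, dotp]
    have hρ' := hρ.ne'
    rcases h with ⟨hA, hB⟩ | ⟨hA, hB⟩ | ⟨hA, hB⟩ | ⟨hA, hB⟩ <;>
      simp [hA, hB, dotp, hρ'] at hz ⊢ <;> first | tauto | linarith
  · by_contra! hne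
    have := (mem_iff hBd (1 / 2, 2)).1 fun e => ?_
    · norm_num at this
    obtain ⟨z, hz⟩ := hne e
    rcases side_cases hBd e with ⟨hA, hB⟩ | ⟨ρ, hρ, h⟩
    · simp [hA, hB, dotp]
    have hρ' := hρ.ne'
    rcases h with ⟨hA, hB⟩ | ⟨hA, hB⟩ | ⟨hA, hB⟩ | ⟨hA, hB⟩ <;>
      simp [hA, hB, dotp, hρ'] at hz ⊢ <;> first | tauto | linarith

theorem dotp_eq_of_sides (hBd : Bd.set = unitSq) {z w : Pt} (h0 : z.1 = 0 → w.1 = 0)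
    (h1 : z.1 = 1 → w.1 = 1) (h2 : z.2 = 0 → w.2 = 0) (h3 : z.2 = 1 → w.2 = 1) {e : Fin Bd.s}
    (he : dotp (Bd.A e) z = Bd.β e) : dotp (Bd.A e) w = Bd.β e := by
  rcases side_cases hBd e with ⟨hA, hB⟩ | ⟨ρ, hρ, h⟩
  · simp [hA, hB, dotp]
  have hρ' := hρ.ne'
  rcases h with ⟨hA, hB⟩ | ⟨hA, hB⟩ | ⟨hA, hB⟩ | ⟨hA, hB⟩ <;>
    simp [hA, hB, dotp, hρ'] at he ⊢ <;> tauto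

end Board

theorem dotp_anorm_false (P : Piece) (hc : 0 < P.c false) (z z' : Pt) :
    dotp (z - z') (P.anorm false) = 0 ↔
      level ((P.d false : ℝ) / P.c false) (flipPt z) =
        level ((P.d false : ℝ) / P.c false) (flipPt z') := by
  have hc' : (P.c false : ℝ) ≠ 0 := by exact_mod_cast hc.ne'
  have h : dotp (z - z') (P.anorm false) = P.c false *
      (level ((P.d false : ℝ) / P.c false) (flipPt z) -
        level ((P.d false : ℝ) / P.c false) (flipPt z')) := by
    simp only [dotp, Piece.anorm, level, flipPt, Prod.fst_sub, Prod.snd_sub]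
    field_simp
    ring
  rw [h, mul_eq_zero, sub_eq_zero]
  simp [hc']

theorem dotp_anorm_true (P : Piece) (hd : 0 < P.d true) (z z' : Pt) :
    dotp (z - z') (P.anorm true) = 0 ↔
      level ((P.c true : ℝ) / P.d true) (flipPt z).swap =
        level ((P.c true : ℝ) / P.d true) (flipPt z').swap := by
  have hd' : (P.d true : ℝ) ≠ 0 := by exact_mod_cast hd.ne'
  have h : dotp (z - z') (P.anorm true) = P.d true *
      (level ((P.c true : ℝ) / P.d true) (flipPt z).swap -
        level ((P.c true : ℝ) / P.d true) (flipPt z').swap) := by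
    simp only [dotp, Piece.anorm, level, flipPt, Prod.fst_sub, Prod.snd_sub, Prod.swap_prod_mk]
    field_simp
    ring
  rw [h, mul_eq_zero, sub_eq_zero]
  simp [hd']

theorem compat_iff {Bd : Board} (hBd : Bd.set = unitSq) (P : Piece) (hc : 0 < P.c false)
    (hd : 0 < P.d true) {q : ℕ} (z w : Conf q) :
    (∀ h ∈ HArr Bd P z, confDot h.1 w = h.2) ↔
      Compat ((P.d false : ℝ) / P.c false) ((P.c true : ℝ) / P.d true)
        (fun i => flipPt (z i)) (fun i => flipPt (w i)) := by
  constructor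
  · intro hw
    have hatt : ∀ i j r, dotp (z i - z j) (P.anorm r) = 0 → dotp (w i - w j) (P.anorm r) = 0 := by
      intro i j r h
      rcases lt_trichotomy i j with hij | rfl | hij
      · rw [← confDot_attackNormal hij.ne]
        exact hw _ (Or.inl ⟨i, j, r, hij, h, rfl⟩)
      · simp [dotp]
      · have hneg : ∀ a b : Pt, dotp (a - b) (P.anorm r) = -dotp (b - a) (P.anorm r) := by
          intro a b
          simp only [dotp, Prod.fst_sub, Prod.snd_sub]
          ring
        rw [hneg, neg_eq_zero] at h ⊢
        rw [← confDot_attackNormal hij.ne]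
        exact hw _ (Or.inl ⟨j, i, r, hij, h, rfl⟩)
    have hfix : ∀ i e, dotp (Bd.A e) (z i) = Bd.β e → dotp (Bd.A e) (w i) = Bd.β e := by
      intro i e h
      rw [← confDot_unitVec]
      exact hw _ (Or.inr ⟨i, e, h, rfl⟩)
    obtain ⟨⟨e0, h0⟩, ⟨e1, h1⟩, ⟨e2, h2⟩, e3, h3⟩ := Board.exists_side hBd
    refine ⟨fun i j h => ?_, fun i j h => ?_, fun i h => ?_, fun i h => ?_, fun i h => ?_,
      fun i h => ?_⟩
    · rw [← dotp_anorm_false P hc] at h ⊢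
      exact hatt i j _ h
    · rw [← dotp_anorm_true P hd] at h ⊢
      exact hatt i j _ h
    · exact (h0 (w i)).1 (hfix i e0 ((h0 (z i)).2 h))
    · exact (h1 (w i)).1 (hfix i e1 ((h1 (z i)).2 h))
    · have := (h3 _).1 (hfix i e3 ((h3 _).2 (by simp only [flipPt] at h; linarith)))
      simp [flipPt, this]
    · have := (h2 _).1 (hfix i e2 ((h2 _).2 (by simp only [flipPt] at h; linarith)))
      simp [flipPt, this]
  · rintro hC _ (⟨i, j, r, hij, h, rfl⟩ | ⟨i, e, h, rfl⟩)
    · rw [confDot_attackNormal hij.ne]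
      cases r
      · rw [dotp_anorm_false P hc] at h ⊢
        exact hC.fst i j h
      · rw [dotp_anorm_true P hd] at h ⊢
        exact hC.snd i j h
    · rw [confDot_unitVec]
      have hb := hC.bot i
      have ht := hC.top i
      simp only [flipPt, sub_eq_zero, sub_eq_self, eq_comm (a := (1 : ℝ))] at hb ht
      exact Board.dotp_eq_of_sides hBd (z := z i) (w := w i) (hC.left i) (hC.right i) ht hb h

theorem isVertex_iff {Bd : Board} (hBd : Bd.set = unitSq) (P : Piece) (hc : 0 < P.c false)
    (hd : 0 < P.d true) {q : ℕ} (z : Conf q) :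
    IsVertex Bd P z ↔ InSquare (fun i => flipPt (z i)) ∧
      Rigid ((P.d false : ℝ) / P.c false) ((P.c true : ℝ) / P.d true)
        (fun i => flipPt (z i)) := by
  have hsq : InBoard Bd z ↔ InSquare (fun i => flipPt (z i)) := by
    refine forall_congr' fun i => (Board.mem_iff hBd (z i)).trans ?_
    simp only [flipPt, sub_nonneg, sub_le_self_iff]
    tauto
  rw [IsVertex, hsq]
  refine and_congr_right fun _ => ⟨?_, fun h => ⟨_, subset_rfl, ?_⟩⟩
  · rintro ⟨H, hH, hz⟩ W hW
    have hmem : (fun i => flipPt (W i)) ∈ {w : Conf q | ∀ h ∈ H, confDot h.1 w = h.2} :=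
      fun h hh => (compat_iff hBd P hc hd z _).2 (by simpa only [flipPt_flipPt] using hW) h (hH hh)
    rw [hz, Set.mem_singleton_iff] at hmem
    funext i
    rw [← congrFun hmem i, flipPt_flipPt]
  · ext w
    rw [Set.mem_ofPred_eq, Set.mem_singleton_iff, compat_iff hBd P hc hd]
    constructor
    · intro hw
      funext i
      rw [← flipPt_flipPt (w i), congrFun (h _ hw) i, flipPt_flipPt]
    · rintro rfl
      exact ⟨fun _ _ => id, fun _ _ => id, fun _ => id, fun _ => id, fun _ => id, fun _ => id⟩

theorem denDvd_ratCast {r : ℚ} {D : ℕ} : DenDvd (r : ℝ) D ↔ r.den ∣ D := by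
  refine ⟨?_, fun h => ⟨r, rfl, h⟩⟩
  rintro ⟨p, hp, h⟩
  rwa [← Rat.cast_injective hp]

theorem denDvd_zero (D : ℕ) : DenDvd 0 D := ⟨0, by simp, by simp⟩

theorem DenDvd.one_sub {x : ℝ} {D : ℕ} (h : DenDvd x D) : DenDvd (1 - x) D := by
  obtain ⟨p, rfl, hp⟩ := h
  refine ⟨1 - p, by push_cast; ring, ?_⟩
  have := Rat.intCast_sub_den 1 p
  rw [Int.cast_one] at this
  rwa [this]

theorem PtDenDvd.flipPt {z : Pt} {D : ℕ} (h : PtDenDvd z D) : PtDenDvd (flipPt z) D :=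
  ⟨h.1, h.2.one_sub⟩

theorem PtDenDvd.reflect {z : Pt} {D : ℕ} (h : PtDenDvd z D) : PtDenDvd (reflect z) D :=
  ⟨h.1.one_sub, h.2.one_sub⟩

theorem PtDenDvd.of_flipPt {z : Pt} {D : ℕ} (h : PtDenDvd (_root_.flipPt z) D) : PtDenDvd z D := by
  simpa only [flipPt_flipPt] using h.flipPt

theorem ptDenQ_dvd_iff {p : ℚ × ℚ} {D : ℕ} :
    ptDenQ p ∣ D ↔ PtDenDvd ((p.1 : ℝ), (p.2 : ℝ)) D := by
  rw [ptDenQ, Nat.lcm_dvd_iff, PtDenDvd, denDvd_ratCast, denDvd_ratCast]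

theorem cast_tRatio (c₁ d₁ c₂ d₂ : ℤ) :
    ((tRatio c₁ d₁ c₂ d₂ : ℚ) : ℝ) = (d₁ / c₁ : ℝ) * (c₂ / d₂) := by
  rw [tRatio]
  push_cast
  rw [mul_div_mul_comm]

theorem ptDenQ_Apt_dvd_iff (c₁ d₁ c₂ d₂ : ℤ) (n D : ℕ) :
    ptDenQ (Apt c₁ d₁ c₂ d₂ (n + 1)) ∣ D ↔
      PtDenDvd (chainPt (d₁ / c₁) (c₂ / d₂) n) D ∧
        PtDenDvd (chainPt (c₂ / d₂) (d₁ / c₁) n).swap D := by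
  have h1 : DenDvd 1 D := ⟨1, by simp, by simp⟩
  have h0 := denDvd_zero D
  rw [ptDenQ_dvd_iff]
  obtain ⟨k, rfl | rfl⟩ := Nat.even_or_odd' n
  · have e1 : (2 * k + 1) % 2 = 1 := by omega
    have e2 : (2 * k + 1 - 1) / 2 = k := by omega
    rw [Apt, if_pos e1, e2, chainPt_even, chainPt_even]
    simp only [PtDenDvd, Prod.swap_prod_mk, Rat.cast_one, Rat.cast_pow, cast_tRatio,
      mul_comm (c₂ / d₂ : ℝ), h1, h0, true_and, and_true, and_self]
  · have e1 : ¬(2 * k + 1 + 1) % 2 = 1 := by omega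
    have e2 : (2 * k + 1 + 1) / 2 - 1 = k := by omega
    rw [Apt, if_neg e1, e2, chainPt_odd, chainPt_odd, mul_comm (c₂ / d₂ : ℝ) (d₁ / c₁)]
    simp only [PtDenDvd, Prod.swap_prod_mk, Rat.cast_mul, Rat.cast_div, Rat.cast_intCast,
      Rat.cast_pow, cast_tRatio, h0, true_and, and_true]

theorem denDvd_neg {x : ℝ} {D : ℕ} : DenDvd (-x) D ↔ DenDvd x D := by
  constructor <;> rintro ⟨p, hp, h⟩ <;> exact ⟨-p, by simp [hp], by rwa [Rat.den_neg_eq_den]⟩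

theorem ptDenQ_Gpt_dvd_iff {c₁ d₁ c₂ d₂ : ℤ} (hc₁ : c₁ ≠ 0) (hd₂ : d₂ ≠ 0)
    (hD : c₁ * d₂ - c₂ * d₁ ≠ 0) (n D : ℕ) :
    ptDenQ (Gpt c₁ d₁ c₂ d₂ (n + 1)) ∣ D ↔
      PtDenDvd (crossPt (d₁ / c₁) (c₂ / d₂) n) D := by
  have hc : (c₁ : ℝ) ≠ 0 := by exact_mod_cast hc₁
  have hd : (d₂ : ℝ) ≠ 0 := by exact_mod_cast hd₂
  have hD' : (c₁ * d₂ - c₂ * d₁ : ℝ) ≠ 0 := by exact_mod_cast hD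
  have ht : (1 - d₁ / c₁ * (c₂ / d₂) : ℝ) = (c₁ * d₂ - c₂ * d₁) / (c₁ * d₂) := by
    field_simp
  rw [ptDenQ_dvd_iff, PtDenDvd, PtDenDvd, ← denDvd_neg (x := (crossPt _ _ n).1)]
  refine iff_of_eq (congrArg₂ _ (congrArg (DenDvd · D) ?_) (congrArg (DenDvd · D) ?_)) <;>
    obtain ⟨k, rfl | rfl⟩ := Nat.even_or_odd' n
  · have e1 : (2 * k + 1) % 2 = 1 := by omega
    have e2 : (2 * k + 1 - 1) / 2 = k := by omega
    rw [Gpt, if_pos e1, e2, crossPt_even, ht]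
    push_cast
    rw [cast_tRatio]
    field_simp
    ring
  · have e1 : ¬(2 * k + 1 + 1) % 2 = 1 := by omega
    have e2 : (2 * k + 1 + 1) / 2 = k + 1 := by omega
    rw [Gpt, if_neg e1, e2, crossPt_odd, ht]
    push_cast
    rw [cast_tRatio]
    field_simp
    ring
  · have e1 : (2 * k + 1) % 2 = 1 := by omega
    have e2 : (2 * k + 1 - 1) / 2 = k := by omega
    rw [Gpt, if_pos e1, e2, crossPt_even, ht]
    push_cast
    rw [cast_tRatio]
    field_simp
  · have e1 : ¬(2 * k + 1 + 1) % 2 = 1 := by omega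
    have e2 : (2 * k + 1 + 1) / 2 = k + 1 := by omega
    rw [Gpt, if_neg e1, e2, crossPt_odd, ht]
    push_cast
    rw [cast_tRatio]
    field_simp

/-- For a piece with slopes `0 < d₁/c₁ < 1 < d₂/c₂` on the square board, the denominator
of `(B^q, A_P^q)` is the lcm of the denominators of `A_1, …, A_q` and of
`G_1, …, G_{⌊(q-1)/2⌋}`. -/
theorem iopDenom_same_sign_slopes (c₁ d₁ c₂ d₂ : ℤ)
    (hc₁ : 0 < c₁) (hd₁ : 0 < d₁) (hc₂ : 0 < c₂) (hd₂ : 0 < d₂)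
    (hg₁ : Int.gcd c₁ d₁ = 1) (hg₂ : Int.gcd c₂ d₂ = 1)
    (hslope₁ : (d₁ : ℚ) / (c₁ : ℚ) < 1) (hslope₂ : 1 < (d₂ : ℚ) / (c₂ : ℚ))
    (P : Piece) (h1 : P.c false = c₁) (h2 : P.d false = d₁)
    (h3 : P.c true = c₂) (h4 : P.d true = d₂)
    (Bd : Board) (hBd : Bd.set = unitSq)
    (q : ℕ) (hq : 1 ≤ q) :
    IsIOPDenom Bd P q
      (Nat.lcm ((Finset.Icc 1 q).lcm fun i => ptDenQ (Apt c₁ d₁ c₂ d₂ i))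
        ((Finset.Icc 1 ((q - 1) / 2)).lcm fun i => ptDenQ (Gpt c₁ d₁ c₂ d₂ i))) := by
  have hc₁' : (0 : ℝ) < c₁ := by exact_mod_cast hc₁
  have hd₁' : (0 : ℝ) < d₁ := by exact_mod_cast hd₁
  have hc₂' : (0 : ℝ) < c₂ := by exact_mod_cast hc₂
  have hd₂' : (0 : ℝ) < d₂ := by exact_mod_cast hd₂
  have hlt₁ : d₁ < c₁ := by
    rw [div_lt_one (by exact_mod_cast hc₁)] at hslope₁
    exact_mod_cast hslope₁
  have hlt₂ : c₂ < d₂ := by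
    rw [one_lt_div (by exact_mod_cast hc₂)] at hslope₂
    exact_mod_cast hslope₂
  have hD : c₁ * d₂ - c₂ * d₁ ≠ 0 := by nlinarith
  have hα0 : (0 : ℝ) < d₁ / c₁ := by positivity
  have hβ0 : (0 : ℝ) < c₂ / d₂ := by positivity
  have hα1 : (d₁ / c₁ : ℝ) < 1 := (div_lt_one hc₁').2 (by exact_mod_cast hlt₁)
  have hβ1 : (c₂ / d₂ : ℝ) < 1 := (div_lt_one hd₂').2 (by exact_mod_cast hlt₂)
  have hV : ∀ z : Conf q, IsVertex Bd P z ↔ InSquare (fun i => flipPt (z i)) ∧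
      Rigid (d₁ / c₁ : ℝ) (c₂ / d₂) (fun i => flipPt (z i)) := by
    intro z
    rw [isVertex_iff hBd P (h1 ▸ hc₁) (h4 ▸ hd₂), h1, h2, h3, h4]
  have hA := ptDenQ_Apt_dvd_iff c₁ d₁ c₂ d₂
  have hG := ptDenQ_Gpt_dvd_iff hc₁.ne' hd₂.ne' hD
  constructor
  · intro z hz i
    obtain ⟨hsq, hrig⟩ := (hV z).1 hz
    refine PtDenDvd.of_flipPt ?_
    have hmain : ∀ p, IsTrajPt (d₁ / c₁ : ℝ) (c₂ / d₂) q p → PtDenDvd p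
        (Nat.lcm ((Finset.Icc 1 q).lcm fun i => ptDenQ (Apt c₁ d₁ c₂ d₂ i))
          ((Finset.Icc 1 ((q - 1) / 2)).lcm fun i => ptDenQ (Gpt c₁ d₁ c₂ d₂ i))) := by
      have hAd : ∀ n < q, _ := fun n hn => (hA n _).1 ((Finset.dvd_lcm
        (f := fun i => ptDenQ (Apt c₁ d₁ c₂ d₂ i))
        (Finset.mem_Icc.2 ⟨Nat.le_add_left 1 n, hn⟩)).trans (Nat.dvd_lcm_left _
          ((Finset.Icc 1 ((q - 1) / 2)).lcm fun i => ptDenQ (Gpt c₁ d₁ c₂ d₂ i))))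
      rintro p (rfl | ⟨n, hn, rfl⟩ | ⟨n, hn, rfl⟩ | ⟨n, hn, rfl⟩)
      · exact ⟨denDvd_zero _, denDvd_zero _⟩
      · exact (hAd n hn).1
      · exact (hAd n hn).2
      · exact (hG n _).1 ((Finset.dvd_lcm (f := fun i => ptDenQ (Gpt c₁ d₁ c₂ d₂ i))
          (Finset.mem_Icc.2 ⟨Nat.le_add_left 1 n, by omega⟩)).trans (Nat.dvd_lcm_right _ _))
    rcases hrig.isTrajPt hsq hα0 hα1 hβ0 hβ1 i with h | h
    · exact hmain _ h
    · simpa [reflect] using (hmain _ h).reflect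
  · intro D hdvd
    have hdvd' : ∀ p, (∃ Z : Fin q → Pt, InSquare Z ∧
        Rigid (d₁ / c₁ : ℝ) (c₂ / d₂) Z ∧ ∃ i, Z i = p) → PtDenDvd p D := by
      rintro _ ⟨Z, hsq, hrig, i, rfl⟩
      refine PtDenDvd.of_flipPt (hdvd (fun i => flipPt (Z i)) ((hV _).2 ?_) i)
      simpa only [flipPt_flipPt] using And.intro hsq hrig
    refine Nat.lcm_dvd (Finset.lcm_dvd fun i hi => ?_) (Finset.lcm_dvd fun i hi => ?_) <;>
      rw [Finset.mem_Icc] at hi <;> obtain ⟨n, rfl⟩ := Nat.exists_eq_add_of_le' hi.1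
    · exact (hA n D).2 ⟨hdvd' _ (exists_rigid_chainPt hα0 hα1 hβ0 hβ1 (by omega)),
        hdvd' _ (exists_rigid_chainPt_swap hα0 hα1 hβ0 hβ1 (by omega))⟩
    · exact (hG n D).2 (hdvd' _ (exists_rigid_crossPt hα0 hα1 hβ0 hβ1 (by omega)))

end
end
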